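/- arXiv:2204.10134 — 2 statements merged into one kernel-verified Lean document; each statement's English description precedes it below -/
import Mathlib

section
/- For every integer n ≥ 7, if G is a maximal outerplanar graph on 2n−3 vertices, then the complement of G contains K_n as a minor. -/
open SimpleGraph

/-- `H` is a minor of `G` (branch-set / minor-model definition): each vertex of `H`
is represented by a connected branch set in `G`, branch sets are pairwise disjoint,
and edges of `H` are realized by edges between the corresponding branch sets. -/
def IsMinorOf {α β : Type*} (H : SimpleGraph α) (G : SimpleGraph β) : Prop :=
  ∃ f : α → Set β,
    (∀ a, (G.induce (f a)).Connected) ∧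
    (∀ a b, a ≠ b → Disjoint (f a) (f b)) ∧
    (∀ a b, H.Adj a b → ∃ u ∈ f a, ∃ v ∈ f b, G.Adj u v)

/-- A maximal outerplanar graph on `Fin n`, with vertices in cyclic order:
it contains the outer cycle `i ~ i+1 (mod n)`, its chords are pairwise
non-crossing, and it is edge-maximal with that property (equivalently, it is a
triangulation of the `n`-gon).  An existing edge `{e,f}` crosses the pair
`{a,b}` (with `a < b`) iff exactly one of its endpoints lies strictly between
`a` and `b`. -/
def IsMaxOuterplanar {n : ℕ} (G : SimpleGraph (Fin n)) : Prop :=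
  (∀ i j : Fin n, (j : ℕ) = ((i : ℕ) + 1) % n → G.Adj i j) ∧
  (∀ a b e f : Fin n, G.Adj a b → G.Adj e f →
    ¬(a < e ∧ e < b ∧ (f < a ∨ b < f))) ∧
  (∀ a b : Fin n, a < b → ¬G.Adj a b →
    ∃ e f : Fin n, G.Adj e f ∧ a < e ∧ e < b ∧ (f < a ∨ b < f))

/-- Non-crossing graphs on `Fin N` (outerplanar with the given cyclic order). -/
def NCr {N : ℕ} (G : SimpleGraph (Fin N)) : Prop :=
  ∀ a b e f : Fin N, G.Adj a b → G.Adj e f → ¬(a < e ∧ e < b ∧ (f < a ∨ b < f))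

/-- The chord `x v` separates `p` from `q`. -/
def MopSep (x v p q : ℕ) : Prop :=
  (((x < p ∧ p < v) ∨ (v < p ∧ p < x)) ∧ ((q < x ∧ q < v) ∨ (x < q ∧ v < q))) ∨
  (((x < q ∧ q < v) ∨ (v < q ∧ q < x)) ∧ ((p < x ∧ p < v) ∨ (x < p ∧ v < p)))

theorem nc_sep {N : ℕ} {G : SimpleGraph (Fin N)} (h : NCr G) {x v p q : Fin N}
    (h1 : G.Adj x v) (h2 : G.Adj p q) : ¬ MopSep x v p q := by
  have a1 := h x v p q h1 h2
  have a2 := h x v q p h1 h2.symm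
  have a3 := h v x p q h1.symm h2
  have a4 := h v x q p h1.symm h2.symm
  simp only [Fin.lt_def] at a1 a2 a3 a4
  unfold MopSep
  omega

theorem nc_path {N : ℕ} {G : SimpleGraph (Fin N)} (h : NCr G) {x v p q w : Fin N}
    (h1 : G.Adj x v) (hs : MopSep x v p q) (h2 : G.Adj p w) (h3 : G.Adj w q) :
    w = x ∨ w = v := by
  have a1 := nc_sep h h1 h2
  have a2 := nc_sep h h1 h3
  rw [Fin.ext_iff, Fin.ext_iff]
  unfold MopSep at *
  omega

theorem sep3_sorted (x p a b c : ℕ) (h1 : x ≠ p) (h2 : x ≠ a) (h3 : x ≠ b) (h4 : x ≠ c)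
    (h5 : p ≠ a) (h6 : p ≠ b) (h7 : p ≠ c) (h8 : a < b) (h10 : b < c) :
    MopSep x a p b ∨ MopSep x a p c ∨ MopSep x b p a ∨ MopSep x b p c ∨ MopSep x c p a ∨
      MopSep x c p b := by
  have hx : x < a ∨ (a < x ∧ x < b) ∨ (b < x ∧ x < c) ∨ c < x := by omega
  have hp : p < a ∨ (a < p ∧ p < b) ∨ (b < p ∧ p < c) ∨ c < p := by omega
  unfold MopSep
  rcases lt_or_gt_of_ne h1 with h1 | h1 <;>
  rcases hx with hx | ⟨hx, hx'⟩ | ⟨hx, hx'⟩ | hx <;>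
  rcases hp with hp | ⟨hp, hp'⟩ | ⟨hp, hp'⟩ | hp <;>
  first
  | (exfalso; omega)
  | (left; omega)
  | (right; left; omega)
  | (right; right; left; omega)
  | (right; right; right; left; omega)
  | (right; right; right; right; left; omega)
  | (right; right; right; right; right; omega)

theorem sep3 (x p a b c : ℕ) (h1 : x ≠ p) (h2 : x ≠ a) (h3 : x ≠ b) (h4 : x ≠ c)
    (h5 : p ≠ a) (h6 : p ≠ b) (h7 : p ≠ c) (h8 : a ≠ b) (h9 : a ≠ c) (h10 : b ≠ c) :
    MopSep x a p b ∨ MopSep x a p c ∨ MopSep x b p a ∨ MopSep x b p c ∨ MopSep x c p a ∨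
      MopSep x c p b := by
  rcases lt_or_gt_of_ne h8 with h8 | h8 <;> rcases lt_or_gt_of_ne h9 with h9 | h9 <;>
  rcases lt_or_gt_of_ne h10 with h10 | h10
  · have := sep3_sorted x p a b c h1 h2 h3 h4 h5 h6 h7 h8 h10; tauto
  · have := sep3_sorted x p a c b h1 h2 h4 h3 h5 h7 h6 h9 h10; tauto
  · omega
  · have := sep3_sorted x p c a b h1 h4 h2 h3 h7 h5 h6 h9 h8; tauto
  · have := sep3_sorted x p b a c h1 h3 h2 h4 h6 h5 h7 h8 h9; tauto
  · omega
  · have := sep3_sorted x p b c a h1 h3 h4 h2 h6 h7 h5 h10 h9; tauto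
  · have := sep3_sorted x p c b a h1 h4 h3 h2 h7 h6 h5 h10 h8; tauto

theorem low_deg {N : ℕ} (hN : 3 ≤ N) {G : SimpleGraph (Fin N)} (h : NCr G) :
    ∃ u x y : Fin N, ∀ w, G.Adj u w → w = x ∨ w = y := by
  classical
  by_cases hex : ∃ d, ∃ i j : Fin N, G.Adj i j ∧ (i : ℕ) + 2 ≤ j ∧ (j : ℕ) - i = d
  · obtain ⟨i, j, hij, h2, hd⟩ := Nat.find_spec hex
    have hmin : ∀ i' j' : Fin N, G.Adj i' j' → (i' : ℕ) + 2 ≤ j' → (j : ℕ) - i ≤ j' - i' := by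
      intro i' j' h' h2'
      rw [hd]
      exact Nat.find_min' hex ⟨i', j', h', h2', rfl⟩
    have hj := j.2
    refine ⟨⟨i + 1, by omega⟩, i, ⟨i + 2, by omega⟩, ?_⟩
    intro w hw
    have a1 := h i j _ w hij hw
    have a2 := hmin _ _ hw
    have a3 := hmin _ _ hw.symm
    have a4 : (i : ℕ) + 1 ≠ w := fun hh => hw.ne (Fin.ext hh)
    simp only [Fin.lt_def, Fin.ext_iff] at *
    omega
  · refine ⟨⟨1, by omega⟩, ⟨0, by omega⟩, ⟨2, by omega⟩, ?_⟩
    intro w hw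
    have a1 : ¬ (1 + 2 ≤ (w : ℕ)) := fun hh => hex ⟨_, _, w, hw, hh, rfl⟩
    have a4 : 1 ≠ (w : ℕ) := fun hh => hw.ne (Fin.ext hh)
    simp only [Fin.ext_iff]
    omega

theorem no3 {N : ℕ} {G : SimpleGraph (Fin N)} (h : NCr G)
    (hfar : ∀ a b, a ≠ b → ¬ G.Adj a b → ∃ c, G.Adj a c ∧ G.Adj b c)
    {x p a b c : Fin N} (hxp : x ≠ p) (hn : ¬ G.Adj x p)
    (ha : G.Adj x a) (hb : G.Adj x b) (hc : G.Adj x c)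
    (hab : a ≠ b) (hac : a ≠ c) (hbc : b ≠ c)
    (hall : (G.Adj p a ∧ G.Adj p b ∧ G.Adj p c) ∨ (¬ G.Adj p a ∧ ¬ G.Adj p b ∧ ¬ G.Adj p c)) :
    False := by
  have key : ∀ v q : Fin N, G.Adj x v → G.Adj x q → MopSep x v p q →
      (G.Adj p v ∧ G.Adj p q) ∨ (¬ G.Adj p v ∧ ¬ G.Adj p q) → False := by
    intro v q hv hq hs hh
    rcases hh with ⟨_, hh⟩ | ⟨h1, h2⟩
    · exact nc_sep h hv hh hs
    · have hpq : p ≠ q := by rintro rfl; exact hn hq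
      obtain ⟨w, hw1, hw2⟩ := hfar p q hpq h2
      rcases nc_path h hv hs hw1 hw2.symm with rfl | rfl
      · exact hn hw1.symm
      · exact h1 hw1
  have e : ∀ {s t : Fin N}, s ≠ t → (s : ℕ) ≠ t := fun hst hh => hst (Fin.ext hh)
  have pa : p ≠ a := by rintro rfl; exact hn ha
  have pb : p ≠ b := by rintro rfl; exact hn hb
  have pc : p ≠ c := by rintro rfl; exact hn hc
  rcases sep3 x p a b c (e hxp) (e ha.ne) (e hb.ne) (e hc.ne) (e pa) (e pb) (e pc)
    (e hab) (e hac) (e hbc) with s | s | s | s | s | s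
  · exact key _ _ ha hb s (by tauto)
  · exact key _ _ ha hc s (by tauto)
  · exact key _ _ hb ha s (by tauto)
  · exact key _ _ hb hc s (by tauto)
  · exact key _ _ hc ha s (by tauto)
  · exact key _ _ hc hb s (by tauto)

open Classical in
theorem dom_of_five {N : ℕ} {G : SimpleGraph (Fin N)} (h : NCr G)
    (hfar : ∀ a b, a ≠ b → ¬ G.Adj a b → ∃ c, G.Adj a c ∧ G.Adj b c)
    {x : Fin N} (h5 : 5 ≤ (Finset.univ.filter (fun w => G.Adj x w)).card) :
    ∀ p, p ≠ x → G.Adj x p := by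
  intro p hp
  by_contra hn
  have hs := Finset.card_filter_add_card_filter_not
    (s := Finset.univ.filter (fun w => G.Adj x w)) (fun w => G.Adj p w)
  have : 2 < ((Finset.univ.filter (fun w => G.Adj x w)).filter (fun w => G.Adj p w)).card ∨
      2 < ((Finset.univ.filter (fun w => G.Adj x w)).filter (fun w => ¬ G.Adj p w)).card := by
    omega
  rcases this with h3 | h3
  · obtain ⟨a, b, c, ha, hb, hc, hab, hac, hbc⟩ := Finset.two_lt_card_iff.1 h3
    simp only [Finset.mem_filter, Finset.mem_univ, true_and] at ha hb hc
    exact no3 h hfar (Ne.symm hp) hn ha.1 hb.1 hc.1 hab hac hbc (Or.inl ⟨ha.2, hb.2, hc.2⟩)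
  · obtain ⟨a, b, c, ha, hb, hc, hab, hac, hbc⟩ := Finset.two_lt_card_iff.1 h3
    simp only [Finset.mem_filter, Finset.mem_univ, true_and] at ha hb hc
    exact no3 h hfar (Ne.symm hp) hn ha.1 hb.1 hc.1 hab hac hbc (Or.inr ⟨ha.2, hb.2, hc.2⟩)

open Classical in
theorem far_or_dom {N : ℕ} (hN : 12 ≤ N) {G : SimpleGraph (Fin N)} (h : NCr G)
    (hfar : ∀ a b, a ≠ b → ¬ G.Adj a b → ∃ c, G.Adj a c ∧ G.Adj b c) :
    ∃ x, ∀ p, p ≠ x → G.Adj x p := by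
  obtain ⟨u, x, y, hu⟩ := low_deg (by omega) h
  have hsub : (Finset.univ : Finset (Fin N)) ⊆
      ({u, x, y} : Finset (Fin N)) ∪ (Finset.univ.filter (fun w => G.Adj x w) ∪
        Finset.univ.filter (fun w => G.Adj y w)) := by
    intro w _
    simp only [Finset.mem_union, Finset.mem_insert, Finset.mem_singleton, Finset.mem_filter,
      Finset.mem_univ, true_and]
    by_cases hw : w = u
    · tauto
    by_cases hw2 : G.Adj u w
    · have := hu w hw2; tauto
    obtain ⟨c, hc1, hc2⟩ := hfar u w (Ne.symm hw) hw2
    rcases hu c hc1 with rfl | rfl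
    · exact Or.inr (Or.inl hc2.symm)
    · exact Or.inr (Or.inr hc2.symm)
  have h1 := Finset.card_le_card hsub
  have h2 := Finset.card_union_le ({u, x, y} : Finset (Fin N))
    (Finset.univ.filter (fun w => G.Adj x w) ∪ Finset.univ.filter (fun w => G.Adj y w))
  have h3 := Finset.card_union_le (Finset.univ.filter (fun w => G.Adj x w))
    (Finset.univ.filter (fun w => G.Adj y w))
  have h4 : ({u, x, y} : Finset (Fin N)).card ≤ 3 := Finset.card_le_three
  rw [Finset.card_univ, Fintype.card_fin] at h1
  by_cases h5 : 5 ≤ (Finset.univ.filter (fun w => G.Adj x w)).card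
  · exact ⟨x, dom_of_five h hfar h5⟩
  · exact ⟨y, dom_of_five h hfar (by omega)⟩

theorem pair_connected {V : Type*} {G : SimpleGraph V} {p q : V} (h : p = q ∨ G.Adj p q) :
    (G.induce {x | x = p ∨ x = q}).Connected := by
  have : Nonempty ({x | x = p ∨ x = q} : Set V) := ⟨⟨p, Or.inl rfl⟩⟩
  have key : ∀ a : ({x | x = p ∨ x = q} : Set V),
      (G.induce {x | x = p ∨ x = q}).Reachable ⟨p, Or.inl rfl⟩ a := by
    rintro ⟨a, ha⟩
    by_cases hpa : p = a
    · subst hpa; exact SimpleGraph.Reachable.refl _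
    · have haq : a = q := by
        rcases ha with ha | ha
        · exact absurd ha.symm hpa
        · exact ha
      subst haq
      apply SimpleGraph.Adj.reachable
      show G.Adj p a
      tauto
  exact ⟨fun a b => (key a).symm.trans (key b)⟩

theorem minor_of_pairs {V : Type*} {G : SimpleGraph V} {n : ℕ} (p q : Fin n → V)
    (h1 : ∀ a, p a = q a ∨ G.Adj (p a) (q a))
    (h2 : ∀ a b, a ≠ b → p a ≠ p b ∧ p a ≠ q b ∧ q a ≠ q b)
    (h3 : ∀ a b, a < b → G.Adj (p a) (p b) ∨ G.Adj (p a) (q b) ∨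
      G.Adj (q a) (p b) ∨ G.Adj (q a) (q b)) :
    IsMinorOf (⊤ : SimpleGraph (Fin n)) G := by
  refine ⟨fun a => {x | x = p a ∨ x = q a}, fun a => pair_connected (h1 a), ?_, ?_⟩
  · intro a b hab
    have e1 := h2 a b hab
    have e2 := h2 b a hab.symm
    rw [Set.disjoint_left]
    rintro x (rfl | rfl) (hx | hx)
    · exact e1.1 hx
    · exact e1.2.1 hx
    · exact e2.2.1 hx.symm
    · exact e1.2.2 hx
  · have key : ∀ a b, a < b → ∃ u ∈ {x | x = p a ∨ x = q a}, ∃ v ∈ {x | x = p b ∨ x = q b},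
        G.Adj u v := by
      intro a b hab
      rcases h3 a b hab with h | h | h | h
      · exact ⟨_, Or.inl rfl, _, Or.inl rfl, h⟩
      · exact ⟨_, Or.inl rfl, _, Or.inr rfl, h⟩
      · exact ⟨_, Or.inr rfl, _, Or.inl rfl, h⟩
      · exact ⟨_, Or.inr rfl, _, Or.inr rfl, h⟩
    intro a b hab
    rcases lt_or_gt_of_ne hab.ne with h | h
    · exact key a b h
    · obtain ⟨u, hu, v, hv, huv⟩ := key b a h
      exact ⟨v, hv, u, hu, huv.symm⟩

theorem fan_case {n N : ℕ} (hn : 7 ≤ n) (hN : N + 3 = 2 * n) {G : SimpleGraph (Fin N)}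
    (h : NCr G) (z : Fin N) (hz : ∀ p, p ≠ z → G.Adj z p) :
    IsMinorOf (⊤ : SimpleGraph (Fin n)) Gᶜ := by
  have hzN := z.2
  let P : ℕ → Fin N := fun i =>
    if hi : z + 1 + i < N then ⟨z + 1 + i, hi⟩ else ⟨(z + 1 + i - N) % N, Nat.mod_lt _ (by omega)⟩
  have Pv : ∀ i, i < N - 1 → (z + 1 + i < N ∧ (P i : ℕ) = z + 1 + i) ∨
      (N ≤ z + 1 + i ∧ (P i : ℕ) = z + 1 + i - N) := by
    intro i hi
    by_cases hh : z + 1 + i < N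
    · left; exact ⟨hh, by simp only [P, dif_pos hh]⟩
    · right
      refine ⟨by omega, ?_⟩
      simp only [P, dif_neg hh]
      exact Nat.mod_eq_of_lt (by omega)
  have Pinj : ∀ i j, i < N - 1 → j < N - 1 → i ≠ j → P i ≠ P j := by
    intro i j hi hj hij he
    have := Pv i hi
    have := Pv j hj
    have he' : (P i : ℕ) = P j := by rw [he]
    omega
  have Pn : ∀ i j, i + 2 ≤ j → j < N - 1 → ¬ G.Adj (P i) (P j) := by
    intro i j hij hj had
    have e1 := Pv i (by omega)
    have e2 := Pv j hj
    have e3 := Pv (i + 1) (by omega)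
    have hk : P (i + 1) ≠ z := by
      intro hh
      have : (P (i + 1) : ℕ) = z := by rw [hh]
      omega
    refine nc_sep h had (hz _ hk) ?_
    unfold MopSep
    omega
  have Pc : ∀ i j, i < N - 1 → j < N - 1 → (i + 2 ≤ j ∨ j + 2 ≤ i) → Gᶜ.Adj (P i) (P j) := by
    intro i j hi hj hij
    rw [SimpleGraph.compl_adj]
    refine ⟨Pinj i j hi hj (by omega), ?_⟩
    rcases hij with hij | hij
    · exact Pn i j hij hj
    · exact fun hh => Pn j i hij hi hh.symm
  let s : ℕ → ℕ := fun a => if a < n - 2 then 2 * a else if a = n - 2 then 1 else 3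
  let t : ℕ → ℕ := fun a => if a < n - 2 then 2 * a else if a = n - 2 then 5 else 7
  have st : ∀ a, a < n → (a < n - 2 ∧ s a = 2 * a ∧ t a = 2 * a) ∨
      (a = n - 2 ∧ s a = 1 ∧ t a = 5) ∨ (a = n - 1 ∧ s a = 3 ∧ t a = 7) := by
    intro a ha
    simp only [s, t]
    split_ifs <;> omega
  refine minor_of_pairs (fun a => P (s a)) (fun a => P (t a)) ?_ ?_ ?_
  · intro a
    rcases st a a.2 with ⟨_, h1, h2⟩ | ⟨_, h1, h2⟩ | ⟨_, h1, h2⟩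
    · left; simp only [h1, h2]
    · right; simp only [h1, h2]; exact Pc _ _ (by omega) (by omega) (by omega)
    · right; simp only [h1, h2]; exact Pc _ _ (by omega) (by omega) (by omega)
  · intro a b hab
    have e1 := st a a.2
    have e2 := st b b.2
    have hab' : (a : ℕ) ≠ b := fun hh => hab (Fin.ext hh)
    refine ⟨Pinj _ _ ?_ ?_ ?_, Pinj _ _ ?_ ?_ ?_, Pinj _ _ ?_ ?_ ?_⟩ <;> omega
  · intro a b hab
    have e1 := st a a.2
    have e2 := st b b.2
    have hab' : (a : ℕ) < b := hab
    have : (s a + 2 ≤ s b ∨ s b + 2 ≤ s a) ∨ (s a + 2 ≤ t b ∨ t b + 2 ≤ s a) := by omega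
    rcases this with hh | hh
    · exact Or.inl (Pc _ _ (by omega) (by omega) hh)
    · exact Or.inr (Or.inl (Pc _ _ (by omega) (by omega) hh))

theorem step_far {n N : ℕ} {G : SimpleGraph (Fin (N + 2))}
    (h : NCr G) (u v : Fin (N + 2)) (huv : u ≠ v) (hn : ¬ G.Adj u v)
    (hc : ∀ c, ¬ (G.Adj u c ∧ G.Adj v c))
    (ih : ∀ G' : SimpleGraph (Fin N), NCr G' → IsMinorOf (⊤ : SimpleGraph (Fin n)) G'ᶜ) :
    IsMinorOf (⊤ : SimpleGraph (Fin (n + 1))) Gᶜ := by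
  have hcard : (({u, v} : Finset (Fin (N + 2)))ᶜ).card = N := by
    rw [Finset.card_compl, Finset.card_pair huv, Fintype.card_fin]; omega
  let e := Finset.orderEmbOfFin _ hcard
  have he : ∀ i, e i ≠ u ∧ e i ≠ v := by
    intro i
    have := Finset.orderEmbOfFin_mem _ hcard i
    simp only [Finset.mem_compl, Finset.mem_insert, Finset.mem_singleton, not_or] at this
    exact this
  obtain ⟨f, f1, f2, f3⟩ := ih (G.comap e) (by
    intro a b c d h1 h2 h3
    apply h (e a) (e b) (e c) (e d) h1 h2
    simpa only [OrderEmbedding.lt_iff_lt] using h3)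
  have hadj : ∀ a b, (G.comap e)ᶜ.Adj a b → Gᶜ.Adj (e a) (e b) := by
    intro a b hab
    rw [SimpleGraph.compl_adj] at hab ⊢
    exact ⟨fun hh => hab.1 (e.injective hh), hab.2⟩
  have hx : ∀ a, ∃ x ∈ ({x | x = u ∨ x = v} : Set (Fin (N + 2))), ∃ y ∈ e '' f a, Gᶜ.Adj x y := by
    intro a
    obtain ⟨w⟩ := (f1 a).nonempty
    by_cases hw : G.Adj u (e w)
    · refine ⟨v, Or.inr rfl, e w, ⟨w, w.2, rfl⟩, ?_⟩
      rw [SimpleGraph.compl_adj]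
      exact ⟨(he _).2.symm, fun hh => hc _ ⟨hw, hh⟩⟩
    · refine ⟨u, Or.inl rfl, e w, ⟨w, w.2, rfl⟩, ?_⟩
      rw [SimpleGraph.compl_adj]
      exact ⟨(he _).1.symm, hw⟩
  have hd : ∀ a, Disjoint ({x | x = u ∨ x = v} : Set (Fin (N + 2))) (e '' f a) := by
    intro a
    rw [Set.disjoint_left]
    rintro x hx ⟨y, _, rfl⟩
    rcases hx with hx | hx
    · exact (he y).1 hx
    · exact (he y).2 hx
  refine ⟨Fin.cons {x | x = u ∨ x = v} (fun a => e '' f a), ?_, ?_, ?_⟩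
  · intro a
    refine Fin.cases ?_ (fun a => ?_) a
    · rw [Fin.cons_zero]
      exact pair_connected (Or.inr ((SimpleGraph.compl_adj _ _ _).2 ⟨huv, hn⟩))
    · rw [Fin.cons_succ]
      let φ : ((G.comap e)ᶜ.induce (f a)) →g (Gᶜ.induce (e '' f a)) :=
        { toFun := fun x => ⟨e x, x, x.2, rfl⟩
          map_rel' := fun {x y} hxy => hadj _ _ hxy }
      refine (f1 a).map φ ?_
      rintro ⟨_, y, hy, rfl⟩
      exact ⟨⟨y, hy⟩, rfl⟩
  · intro a b
    refine Fin.cases ?_ (fun a => ?_) a <;> refine Fin.cases ?_ (fun b => ?_) b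
    · intro hh; exact absurd rfl hh
    · intro _; simp only [Fin.cons_zero, Fin.cons_succ]; exact hd b
    · intro _; simp only [Fin.cons_zero, Fin.cons_succ]; exact (hd a).symm
    · intro hab
      simp only [Fin.cons_succ]
      exact (Set.disjoint_image_iff e.injective).2 (f2 a b (fun hh => hab (by rw [hh])))
  · intro a b
    refine Fin.cases ?_ (fun a => ?_) a <;> refine Fin.cases ?_ (fun b => ?_) b
    · intro hh; exact absurd rfl hh.ne
    · intro _; simp only [Fin.cons_zero, Fin.cons_succ]; exact hx b
    · intro _; simp only [Fin.cons_zero, Fin.cons_succ]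
      obtain ⟨x, hx1, y, hy, hxy⟩ := hx a
      exact ⟨y, hy, x, hx1, hxy.symm⟩
    · intro hab
      simp only [Fin.cons_succ]
      have : a ≠ b := fun hh => hab.ne (by rw [hh])
      obtain ⟨x, hx1, y, hy, hxy⟩ := f3 a b this
      exact ⟨e x, ⟨x, hx1, rfl⟩, e y, ⟨y, hy, rfl⟩, hadj _ _ hxy⟩

def mopBit (m u v : ℕ) : Bool := 
  Nat.beq (Nat.land (nat_lit 1) (Nat.shiftRight m (Nat.add (Nat.mul (nat_lit 11) u) v))) (nat_lit 1)

theorem mopBit_eq (m u v : ℕ) : mopBit m u v = Nat.testBit m (11 * u + v) := by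
  have e : mopBit m u v = Nat.beq (1 &&& (m >>> (11 * u + v))) 1 := rfl
  rw [e, Nat.testBit, Bool.eq_iff_iff, Nat.beq_eq, Nat.land_comm, Nat.and_one_is_mod]
  rcases Nat.mod_two_eq_zero_or_one (m >>> (11 * u + v)) with h | h <;> simp [h]

def mopAdd (m a b : ℕ) : ℕ :=
  Nat.lor m (Nat.lor (Nat.shiftLeft 1 (11 * a + b)) (Nat.shiftLeft 1 (11 * b + a)))

/-- Evaluate a natural number before passing it on. -/
def mopForce (m : ℕ) (f : ℕ → Bool) : Bool :=
  match m with
  | 0 => f 0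
  | k + 1 => f (k + 1)

theorem mopForce_eq (m : ℕ) (f : ℕ → Bool) : mopForce m f = f m := by
  cases m <;> rfl

def mopOk (m : ℕ) (p q : ℕ × ℕ) : Bool :=
  !(mopBit m p.1 q.1 && (mopBit m p.1 q.2 && (mopBit m p.2 q.1 && mopBit m p.2 q.2)))

def mopChk (m : ℕ) : List (ℕ × ℕ) → Bool
  | [] => true
  | p :: l => (Nat.beq p.1 p.2 || !mopBit m p.1 p.2) && (l.all (mopOk m p) && mopChk m l)

def mopDisj (p q : ℕ × ℕ) : Bool :=
  !(Nat.beq p.1 q.1) && (!(Nat.beq p.1 q.2) && (!(Nat.beq p.2 q.1) && !(Nat.beq p.2 q.2)))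

def mopWf : List (ℕ × ℕ) → Bool
  | [] => true
  | p :: l => Nat.ble p.1 10 && Nat.ble p.2 10 && (l.all (mopDisj p) && mopWf l)

/-- A `K₇` model as a list of branch sets `{u, v}`; the first component is only a quick filter
(a mask of edges which have to be absent). -/
def mopModels : List (ℕ × List (ℕ × ℕ)) :=
  [(nat_lit 9232388032471564416,
    [(nat_lit 1, nat_lit 1), (nat_lit 5, nat_lit 5), (nat_lit 8, nat_lit 8), (nat_lit 0, nat_lit 7), (nat_lit 2, nat_lit 6), (nat_lit 3, nat_lit 10), (nat_lit 4, nat_lit 9)]),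
   (nat_lit 75557868233916560769152,
    [(nat_lit 2, nat_lit 2), (nat_lit 6, nat_lit 6), (nat_lit 10, nat_lit 10), (nat_lit 0, nat_lit 7), (nat_lit 1, nat_lit 5), (nat_lit 3, nat_lit 9), (nat_lit 4, nat_lit 8)]),
   (nat_lit 75576310471088619454480,
    [(nat_lit 1, nat_lit 1), (nat_lit 5, nat_lit 5), (nat_lit 9, nat_lit 9), (nat_lit 0, nat_lit 4), (nat_lit 2, nat_lit 8), (nat_lit 3, nat_lit 7), (nat_lit 6, nat_lit 10)]),
   (nat_lit 75576310479334419202064,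
    [(nat_lit 3, nat_lit 3), (nat_lit 6, nat_lit 6), (nat_lit 10, nat_lit 10), (nat_lit 0, nat_lit 4), (nat_lit 1, nat_lit 8), (nat_lit 2, nat_lit 7), (nat_lit 5, nat_lit 9)]),
   (nat_lit 75557865979915307909264,
    [(nat_lit 0, nat_lit 0), (nat_lit 4, nat_lit 4), (nat_lit 7, nat_lit 7), (nat_lit 1, nat_lit 5), (nat_lit 2, nat_lit 9), (nat_lit 3, nat_lit 8), (nat_lit 6, nat_lit 10)]),
   (nat_lit 36897996145630412864,
    [(nat_lit 1, nat_lit 1), (nat_lit 4, nat_lit 4), (nat_lit 8, nat_lit 8), (nat_lit 0, nat_lit 6), (nat_lit 2, nat_lit 7), (nat_lit 3, nat_lit 9), (nat_lit 5, nat_lit 10)]),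
   (nat_lit 9241390833679467016,
    [(nat_lit 0, nat_lit 0), (nat_lit 3, nat_lit 3), (nat_lit 9, nat_lit 9), (nat_lit 1, nat_lit 7), (nat_lit 2, nat_lit 6), (nat_lit 4, nat_lit 10), (nat_lit 5, nat_lit 8)]),
   (nat_lit 75557872742460501000224,
    [(nat_lit 3, nat_lit 3), (nat_lit 6, nat_lit 6), (nat_lit 10, nat_lit 10), (nat_lit 0, nat_lit 5), (nat_lit 1, nat_lit 7), (nat_lit 2, nat_lit 8), (nat_lit 4, nat_lit 9)]),
   (nat_lit 154742504915186029863895072,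
    [(nat_lit 3, nat_lit 3), (nat_lit 7, nat_lit 7), (nat_lit 10, nat_lit 10), (nat_lit 0, nat_lit 5), (nat_lit 1, nat_lit 9), (nat_lit 2, nat_lit 6), (nat_lit 4, nat_lit 8)]),
   (nat_lit 4620702014446764196,
    [(nat_lit 0, nat_lit 0), (nat_lit 2, nat_lit 2), (nat_lit 5, nat_lit 5), (nat_lit 7, nat_lit 7), (nat_lit 1, nat_lit 8), (nat_lit 3, nat_lit 10), (nat_lit 4, nat_lit 9)]),
   (nat_lit 18451248227388260480,
    [(nat_lit 1, nat_lit 1), (nat_lit 4, nat_lit 4), (nat_lit 8, nat_lit 8), (nat_lit 0, nat_lit 7), (nat_lit 2, nat_lit 10), (nat_lit 3, nat_lit 6), (nat_lit 5, nat_lit 9)]),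
   (nat_lit 37815827602906810941448,
    [(nat_lit 2, nat_lit 2), (nat_lit 6, nat_lit 6), (nat_lit 9, nat_lit 9), (nat_lit 0, nat_lit 3), (nat_lit 1, nat_lit 8), (nat_lit 4, nat_lit 7), (nat_lit 5, nat_lit 10)]),
   (nat_lit 154742504919689629356130560,
    [(nat_lit 3, nat_lit 3), (nat_lit 7, nat_lit 7), (nat_lit 10, nat_lit 10), (nat_lit 0, nat_lit 8), (nat_lit 1, nat_lit 6), (nat_lit 2, nat_lit 5), (nat_lit 4, nat_lit 9)]),
   (nat_lit 154742523357418807163420736,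
    [(nat_lit 1, nat_lit 1), (nat_lit 5, nat_lit 5), (nat_lit 9, nat_lit 9), (nat_lit 0, nat_lit 6), (nat_lit 2, nat_lit 4), (nat_lit 3, nat_lit 8), (nat_lit 7, nat_lit 10)]),
   (nat_lit 75557865979915307909384,
    [(nat_lit 0, nat_lit 0), (nat_lit 3, nat_lit 3), (nat_lit 8, nat_lit 8), (nat_lit 1, nat_lit 5), (nat_lit 2, nat_lit 9), (nat_lit 4, nat_lit 7), (nat_lit 6, nat_lit 10)]),
   (nat_lit 18889483946152505770496,
    [(nat_lit 1, nat_lit 1), (nat_lit 6, nat_lit 6), (nat_lit 8, nat_lit 8), (nat_lit 0, nat_lit 9), (nat_lit 2, nat_lit 7), (nat_lit 3, nat_lit 5), (nat_lit 4, nat_lit 10)]),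
   (nat_lit 75557865982112318357648,
    [(nat_lit 0, nat_lit 0), (nat_lit 4, nat_lit 4), (nat_lit 7, nat_lit 7), (nat_lit 1, nat_lit 8), (nat_lit 2, nat_lit 5), (nat_lit 3, nat_lit 9), (nat_lit 6, nat_lit 10)]),
   (nat_lit 18889474947475270861124,
    [(nat_lit 0, nat_lit 0), (nat_lit 2, nat_lit 2), (nat_lit 6, nat_lit 6), (nat_lit 8, nat_lit 8), (nat_lit 1, nat_lit 5), (nat_lit 3, nat_lit 10), (nat_lit 4, nat_lit 9)]),
   (nat_lit 75567087107299174547584,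
    [(nat_lit 3, nat_lit 3), (nat_lit 6, nat_lit 6), (nat_lit 10, nat_lit 10), (nat_lit 0, nat_lit 7), (nat_lit 1, nat_lit 4), (nat_lit 2, nat_lit 9), (nat_lit 5, nat_lit 8)]),
   (nat_lit 37778934123554142224528,
    [(nat_lit 0, nat_lit 0), (nat_lit 4, nat_lit 4), (nat_lit 7, nat_lit 7), (nat_lit 1, nat_lit 5), (nat_lit 2, nat_lit 8), (nat_lit 3, nat_lit 10), (nat_lit 6, nat_lit 9)]),
   (nat_lit 75576310472187595325456,
    [(nat_lit 1, nat_lit 1), (nat_lit 6, nat_lit 6), (nat_lit 10, nat_lit 10), (nat_lit 0, nat_lit 4), (nat_lit 2, nat_lit 7), (nat_lit 3, nat_lit 8), (nat_lit 5, nat_lit 9)]),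
   (nat_lit 18464759022512242820,
    [(nat_lit 0, nat_lit 0), (nat_lit 2, nat_lit 2), (nat_lit 7, nat_lit 7), (nat_lit 1, nat_lit 8), (nat_lit 3, nat_lit 6), (nat_lit 4, nat_lit 10), (nat_lit 5, nat_lit 9)]),
   (nat_lit 18448998076842573888,
    [(nat_lit 1, nat_lit 1), (nat_lit 5, nat_lit 5), (nat_lit 9, nat_lit 9), (nat_lit 0, nat_lit 6), (nat_lit 2, nat_lit 10), (nat_lit 3, nat_lit 8), (nat_lit 4, nat_lit 7)]),
   (nat_lit 77371289348829912427397768,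
    [(nat_lit 0, nat_lit 0), (nat_lit 3, nat_lit 3), (nat_lit 7, nat_lit 7), (nat_lit 9, nat_lit 9), (nat_lit 1, nat_lit 8), (nat_lit 2, nat_lit 6), (nat_lit 5, nat_lit 10)]),
   (nat_lit 154742514154315167857672192,
    [(nat_lit 1, nat_lit 1), (nat_lit 4, nat_lit 4), (nat_lit 7, nat_lit 7), (nat_lit 10, nat_lit 10), (nat_lit 2, nat_lit 6), (nat_lit 3, nat_lit 9), (nat_lit 5, nat_lit 8)]),
   (nat_lit 18907918306155631214928,
    [(nat_lit 0, nat_lit 0), (nat_lit 4, nat_lit 4), (nat_lit 6, nat_lit 6), (nat_lit 8, nat_lit 8), (nat_lit 2, nat_lit 10), (nat_lit 3, nat_lit 7), (nat_lit 5, nat_lit 9)]),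
   (nat_lit 316912744504410651665660657696,
    [(nat_lit 4, nat_lit 4), (nat_lit 6, nat_lit 6), (nat_lit 8, nat_lit 8), (nat_lit 10, nat_lit 10), (nat_lit 0, nat_lit 5), (nat_lit 1, nat_lit 3), (nat_lit 2, nat_lit 7)]),
   (nat_lit 9225626310839107880,
    [(nat_lit 0, nat_lit 0), (nat_lit 3, nat_lit 3), (nat_lit 5, nat_lit 5), (nat_lit 8, nat_lit 8), (nat_lit 1, nat_lit 9), (nat_lit 2, nat_lit 6), (nat_lit 4, nat_lit 7)]),
   (nat_lit 77371252456467668941209856,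
    [(nat_lit 3, nat_lit 3), (nat_lit 7, nat_lit 7), (nat_lit 9, nat_lit 9), (nat_lit 0, nat_lit 8), (nat_lit 1, nat_lit 5), (nat_lit 2, nat_lit 10), (nat_lit 4, nat_lit 6)]),
   (nat_lit 77446819553693217427833488,
    [(nat_lit 0, nat_lit 0), (nat_lit 4, nat_lit 4), (nat_lit 7, nat_lit 7), (nat_lit 9, nat_lit 9), (nat_lit 1, nat_lit 3), (nat_lit 5, nat_lit 8), (nat_lit 6, nat_lit 10)]),
   (nat_lit 4612816320676233736,
    [(nat_lit 0, nat_lit 0), (nat_lit 3, nat_lit 3), (nat_lit 9, nat_lit 9), (nat_lit 1, nat_lit 8), (nat_lit 2, nat_lit 10), (nat_lit 4, nat_lit 6), (nat_lit 5, nat_lit 7)]),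
   (nat_lit 316912650057058477375744376864,
    [(nat_lit 1, nat_lit 1), (nat_lit 8, nat_lit 8), (nat_lit 10, nat_lit 10), (nat_lit 0, nat_lit 5), (nat_lit 2, nat_lit 9), (nat_lit 3, nat_lit 7), (nat_lit 4, nat_lit 6)]),
   (nat_lit 316912650061669040790918463504,
    [(nat_lit 1, nat_lit 1), (nat_lit 5, nat_lit 5), (nat_lit 7, nat_lit 7), (nat_lit 0, nat_lit 4), (nat_lit 2, nat_lit 6), (nat_lit 3, nat_lit 9), (nat_lit 8, nat_lit 10)]),
   (nat_lit 77446810319064380595044372,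
    [(nat_lit 0, nat_lit 0), (nat_lit 2, nat_lit 2), (nat_lit 4, nat_lit 4), (nat_lit 1, nat_lit 5), (nat_lit 3, nat_lit 8), (nat_lit 6, nat_lit 10), (nat_lit 7, nat_lit 9)]),
   (nat_lit 75567096105152647790600,
    [(nat_lit 2, nat_lit 2), (nat_lit 4, nat_lit 4), (nat_lit 9, nat_lit 9), (nat_lit 0, nat_lit 3), (nat_lit 1, nat_lit 7), (nat_lit 5, nat_lit 8), (nat_lit 6, nat_lit 10)]),
   (nat_lit 18889474947474466570272,
    [(nat_lit 1, nat_lit 1), (nat_lit 4, nat_lit 4), (nat_lit 9, nat_lit 9), (nat_lit 0, nat_lit 5), (nat_lit 2, nat_lit 7), (nat_lit 3, nat_lit 10), (nat_lit 6, nat_lit 8)]),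
   (nat_lit 18889483950276479287328,
    [(nat_lit 2, nat_lit 2), (nat_lit 6, nat_lit 6), (nat_lit 8, nat_lit 8), (nat_lit 0, nat_lit 5), (nat_lit 1, nat_lit 7), (nat_lit 3, nat_lit 9), (nat_lit 4, nat_lit 10)]),
   (nat_lit 316912650061691554396176908352,
    [(nat_lit 2, nat_lit 2), (nat_lit 4, nat_lit 4), (nat_lit 8, nat_lit 8), (nat_lit 10, nat_lit 10), (nat_lit 0, nat_lit 6), (nat_lit 1, nat_lit 9), (nat_lit 5, nat_lit 7)]),
   (nat_lit 75557872733389530071080,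
    [(nat_lit 0, nat_lit 0), (nat_lit 3, nat_lit 3), (nat_lit 5, nat_lit 5), (nat_lit 1, nat_lit 7), (nat_lit 2, nat_lit 8), (nat_lit 4, nat_lit 9), (nat_lit 6, nat_lit 10)]),
   (nat_lit 316912650057058480672464961620,
    [(nat_lit 0, nat_lit 0), (nat_lit 2, nat_lit 2), (nat_lit 4, nat_lit 4), (nat_lit 6, nat_lit 6), (nat_lit 1, nat_lit 7), (nat_lit 3, nat_lit 9), (nat_lit 8, nat_lit 10)]),
   (nat_lit 154742504911802832651354196,
    [(nat_lit 0, nat_lit 0), (nat_lit 2, nat_lit 2), (nat_lit 4, nat_lit 4), (nat_lit 6, nat_lit 6), (nat_lit 1, nat_lit 5), (nat_lit 3, nat_lit 9), (nat_lit 7, nat_lit 10)])]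

def mopGo : ℕ → List (ℕ × ℕ) → ℕ → Bool
  | 0, _, _ => false
  | _ + 1, [], m => mopModels.any fun M =>
      Nat.beq (Nat.land m M.1) (nat_lit 0) && mopChk m M.2
  | k + 1, (a, b) :: st, m =>
    mopForce (mopAdd m a b) fun m' =>
      match Nat.ble b (a + 1) with
      | true => mopGo k st m'
      | false => (List.range (b - a - 1)).all fun i =>
          mopForce (a + 1 + i) fun c => mopGo k ((a, c) :: (c, b) :: st) m'

set_option maxRecDepth 100000 in
theorem mopGo_true : mopGo 25 [(0, 10)] 0 = true := by
  decide +kernel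

theorem mopWf_true : mopModels.all (fun M => Nat.beq M.2.length 7 && mopWf M.2) = true := by
  decide +kernel

theorem mopBit_add {m a b u v : ℕ} (h : mopBit m u v = true ∨ (u = a ∧ v = b) ∨ (u = b ∧ v = a)) :
    mopBit (mopAdd m a b) u v = true := by
  have e : mopAdd m a b = m ||| ((1 <<< (11 * a + b)) ||| (1 <<< (11 * b + a))) := rfl
  rw [mopBit_eq] at *
  rw [e, Nat.testBit_or, Nat.testBit_or]
  rcases h with h | ⟨rfl, rfl⟩ | ⟨rfl, rfl⟩
  · simp [h]
  · simp [Nat.testBit_shiftLeft]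
  · simp [Nat.testBit_shiftLeft]

theorem nc_split {N : ℕ} {G : SimpleGraph (Fin N)} (h : NCr G) (a b : ℕ) (_hb : b < N)
    (hab : a + 1 < b) : ∃ c, a < c ∧ c < b ∧ ∀ u v : Fin N, G.Adj u v → u < v → a ≤ u → v ≤ b →
      ((u : ℕ) = a ∧ (v : ℕ) = b) ∨ (v : ℕ) ≤ c ∨ c ≤ u := by
  classical
  let S : Finset ℕ := (Finset.Ioo a b).filter
    (fun c => ∃ (x y : Fin N), G.Adj x y ∧ (x : ℕ) = a ∧ (y : ℕ) = c)
  by_cases hS : S.Nonempty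
  · have hm := S.max'_mem hS
    have hmax : ∀ d ∈ S, d ≤ S.max' hS := fun d hd => S.le_max' d hd
    generalize S.max' hS = c at *
    simp only [S, Finset.mem_filter, Finset.mem_Ioo] at hm hmax
    obtain ⟨⟨h1, h2⟩, x, y, hxy, hx, hy⟩ := hm
    refine ⟨c, h1, h2, ?_⟩
    intro u v huv hlt hau hvb
    have e1 := nc_sep h hxy huv
    have e2 := hmax v
    unfold MopSep at e1
    have hlt' : (u : ℕ) < v := hlt
    by_contra hcon
    push Not at hcon
    by_cases hua : (u : ℕ) = a
    · have := e2 ⟨⟨by omega, by have := hcon.1 hua; omega⟩, u, v, huv, hua, rfl⟩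
      omega
    · omega
  · refine ⟨a + 1, by omega, hab, ?_⟩
    intro u v huv hlt hau hvb
    have hlt' : (u : ℕ) < v := hlt
    by_contra hcon
    push Not at hcon
    apply hS
    refine ⟨v, ?_⟩
    simp only [S, Finset.mem_filter, Finset.mem_Ioo]
    have hua : (u : ℕ) = a := by omega
    have := hcon.1 hua
    exact ⟨⟨by omega, by omega⟩, u, v, huv, hua, rfl⟩

theorem mopGo_sound {G : SimpleGraph (Fin 11)} (h : NCr G) (k : ℕ) :
    ∀ (st : List (ℕ × ℕ)) (m : ℕ), mopGo k st m = true →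
      (∀ p ∈ st, p.1 < p.2 ∧ p.2 ≤ 10) →
      (∀ u v : Fin 11, G.Adj u v → u < v → (mopBit m u v = true ∧ mopBit m v u = true) ∨
        ∃ p ∈ st, p.1 ≤ u ∧ (v : ℕ) ≤ p.2) →
      ∃ m', ∃ M ∈ mopModels, mopChk m' M.2 = true ∧
        ∀ u v : Fin 11, G.Adj u v → mopBit m' u v = true := by
  induction k with
  | zero => intro st m hg; simp [mopGo] at hg
  | succ k ih =>
    intro st m hg hst hm
    rcases st with _ | ⟨⟨a, b⟩, st⟩
    · simp only [mopGo, List.any_eq_true] at hg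
      obtain ⟨M, hM, hc⟩ := hg
      refine ⟨m, M, hM, (Bool.and_eq_true_iff.1 hc).2, ?_⟩
      intro u v huv
      rcases lt_or_gt_of_ne huv.ne with hl | hl
      · rcases hm u v huv hl with hh | ⟨p, hp, _⟩
        · exact hh.1
        · simp at hp
      · rcases hm v u huv.symm hl with hh | ⟨p, hp, _⟩
        · exact hh.2
        · simp at hp
    · simp only [mopGo, mopForce_eq] at hg
      have hab := hst (a, b) (by simp)
      simp only at hab
      have hst' : ∀ p ∈ st, p.1 < p.2 ∧ p.2 ≤ 10 := fun p hp => hst p (by simp [hp])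
      cases hb : Nat.ble b (a + 1) with
      | true =>
        rw [hb] at hg
        have hb' := Nat.le_of_ble_eq_true hb
        apply ih st _ hg hst'
        intro u v huv hl
        have hl' : (u : ℕ) < v := hl
        rcases hm u v huv hl with hh | ⟨p, hp, h1, h2⟩
        · exact Or.inl ⟨mopBit_add (Or.inl hh.1), mopBit_add (Or.inl hh.2)⟩
        · rcases List.mem_cons.1 hp with rfl | hp
          · simp only at h1 h2
            have e1 : (u : ℕ) = a := by omega
            have e2 : (v : ℕ) = b := by omega
            exact Or.inl ⟨mopBit_add (by tauto), mopBit_add (by tauto)⟩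
          · exact Or.inr ⟨p, hp, h1, h2⟩
      | false =>
        rw [hb] at hg
        simp only [List.all_eq_true, List.mem_range] at hg
        have hb' : a + 1 < b := by
          by_contra hcon
          rw [Nat.ble_eq_true_of_le (by omega)] at hb
          exact absurd hb (by simp)
        obtain ⟨c, hc1, hc2, hc⟩ := nc_split h a b (by omega) hb'
        have hg' := hg (c - a - 1) (by omega)
        have ec : a + 1 + (c - a - 1) = c := by omega
        rw [ec] at hg'
        apply ih _ _ hg'
        · intro p hp
          rcases List.mem_cons.1 hp with rfl | hp
          · simp only; omega
          rcases List.mem_cons.1 hp with rfl | hp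
          · simp only; omega
          exact hst' p hp
        · intro u v huv hl
          rcases hm u v huv hl with hh | ⟨p, hp, h1, h2⟩
          · exact Or.inl ⟨mopBit_add (Or.inl hh.1), mopBit_add (Or.inl hh.2)⟩
          · rcases List.mem_cons.1 hp with rfl | hp
            · simp only at h1 h2
              rcases hc u v huv hl h1 h2 with e | e | e
              · exact Or.inl ⟨mopBit_add (by tauto), mopBit_add (by tauto)⟩
              · exact Or.inr ⟨(a, c), by simp, h1, e⟩
              · exact Or.inr ⟨(c, b), by simp, e, h2⟩
            · exact Or.inr ⟨p, by simp [hp], h1, h2⟩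

theorem mopChk_sound (m : ℕ) (M : List (ℕ × ℕ)) (h : mopChk m M = true) :
    (∀ p ∈ M, p.1 = p.2 ∨ mopBit m p.1 p.2 = false) ∧
    M.Pairwise (fun p q => mopOk m p q = true) := by
  induction M with
  | nil => simp
  | cons p l ih =>
    simp only [mopChk, Bool.and_eq_true, Bool.or_eq_true, Nat.beq_eq, Bool.not_eq_true',
      List.all_eq_true] at h
    obtain ⟨h1, h2, h3⟩ := h
    obtain ⟨i1, i2⟩ := ih h3
    refine ⟨?_, List.pairwise_cons.2 ⟨h2, i2⟩⟩
    intro q hq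
    rcases List.mem_cons.1 hq with rfl | hq
    · exact h1
    · exact i1 q hq

theorem mopWf_sound (M : List (ℕ × ℕ)) (h : mopWf M = true) :
    (∀ p ∈ M, p.1 ≤ 10 ∧ p.2 ≤ 10) ∧
    M.Pairwise (fun p q => p.1 ≠ q.1 ∧ p.1 ≠ q.2 ∧ p.2 ≠ q.1 ∧ p.2 ≠ q.2) := by
  induction M with
  | nil => simp
  | cons p l ih =>
    simp only [mopWf, Bool.and_eq_true, List.all_eq_true] at h
    obtain ⟨⟨h1, h1'⟩, h2, h3⟩ := h
    obtain ⟨i1, i2⟩ := ih h3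
    refine ⟨?_, List.pairwise_cons.2 ⟨?_, i2⟩⟩
    · intro q hq
      rcases List.mem_cons.1 hq with rfl | hq
      · exact ⟨Nat.le_of_ble_eq_true h1, Nat.le_of_ble_eq_true h1'⟩
      · exact i1 q hq
    · intro q hq
      have := h2 q hq
      simp only [mopDisj, Bool.and_eq_true, Bool.not_eq_true', ← Bool.not_eq_true, Nat.beq_eq] at this
      exact this

theorem base_case {G : SimpleGraph (Fin 11)} (h : NCr G) :
    IsMinorOf (⊤ : SimpleGraph (Fin 7)) Gᶜ := by
  obtain ⟨m, ⟨A, M⟩, hM, hc, hG⟩ := mopGo_sound h 25 [(0, 10)] 0 mopGo_true (by simp) (by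
    intro u v _ _
    exact Or.inr ⟨(0, 10), by simp, by simp, by have := v.2; simp only; omega⟩)
  have hw := List.all_eq_true.1 mopWf_true _ hM
  rw [Bool.and_eq_true, Nat.beq_eq] at hw
  obtain ⟨hl, hw⟩ := hw
  obtain ⟨c1, c2⟩ := mopChk_sound m M hc
  obtain ⟨w1, w2⟩ := mopWf_sound M hw
  have hi : ∀ a : Fin 7, (a : ℕ) < M.length := fun a => by rw [hl]; exact a.2
  have hmem : ∀ a : Fin 7, M[(a : ℕ)]'(hi a) ∈ M := fun a => List.getElem_mem _
  have b1 : ∀ a : Fin 7, (M[(a : ℕ)]'(hi a)).1 < 11 := fun a => by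
    have := (w1 _ (hmem a)).1; omega
  have b2 : ∀ a : Fin 7, (M[(a : ℕ)]'(hi a)).2 < 11 := fun a => by
    have := (w1 _ (hmem a)).2; omega
  have hdis : ∀ a b : Fin 7, a < b → _ := fun a b hab =>
    List.pairwise_iff_getElem.1 w2 a b (hi a) (hi b) hab
  have hadj : ∀ u v : Fin 11, u ≠ v → mopBit m u v = false → Gᶜ.Adj u v := by
    intro u v huv hb
    rw [SimpleGraph.compl_adj]
    refine ⟨huv, fun hh => ?_⟩
    rw [hG u v hh] at hb
    exact absurd hb (by simp)
  refine minor_of_pairs (fun a => ⟨(M[(a : ℕ)]'(hi a)).1, b1 a⟩)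
    (fun a => ⟨(M[(a : ℕ)]'(hi a)).2, b2 a⟩) ?_ ?_ ?_
  · intro a
    by_cases he : (M[(a : ℕ)]'(hi a)).1 = (M[(a : ℕ)]'(hi a)).2
    · exact Or.inl (Fin.ext he)
    · right
      apply hadj
      · simpa [Fin.ext_iff] using he
      · exact (c1 _ (hmem a)).resolve_left he
  · intro a b hab
    simp only [ne_eq, Fin.mk.injEq]
    rcases lt_or_gt_of_ne hab with hlt | hlt
    · obtain ⟨d1, d2, d3, d4⟩ := hdis a b hlt
      exact ⟨d1, d2, d4⟩
    · obtain ⟨d1, d2, d3, d4⟩ := hdis b a hlt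
      exact ⟨fun hh => d1 hh.symm, fun hh => d3 hh.symm, fun hh => d4 hh.symm⟩
  · intro a b hab
    obtain ⟨d1, d2, d3, d4⟩ := hdis a b hab
    have ho := List.pairwise_iff_getElem.1 c2 a b (hi a) (hi b) hab
    simp only [mopOk, Bool.not_eq_true', Bool.and_eq_false_iff] at ho
    rcases ho with ho | ho | ho | ho
    · exact Or.inl (hadj _ _ (fun hh => d1 (congrArg Fin.val hh)) ho)
    · exact Or.inr (Or.inl (hadj _ _ (fun hh => d2 (congrArg Fin.val hh)) ho))
    · exact Or.inr (Or.inr (Or.inl (hadj _ _ (fun hh => d3 (congrArg Fin.val hh)) ho)))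
    · exact Or.inr (Or.inr (Or.inr (hadj _ _ (fun hh => d4 (congrArg Fin.val hh)) ho)))

theorem nc_main (n : ℕ) (hn : 7 ≤ n) : ∀ N, N + 3 = 2 * n → ∀ G : SimpleGraph (Fin N), NCr G →
    IsMinorOf (⊤ : SimpleGraph (Fin n)) Gᶜ := by
  induction n, hn using Nat.le_induction with
  | base =>
    intro N hN G h
    obtain rfl : N = 11 := by omega
    exact base_case h
  | succ n hn ih =>
    intro N hN G h
    obtain ⟨N, rfl⟩ : ∃ N', N = N' + 2 := ⟨N - 2, by omega⟩
    by_cases hfar : ∀ a b, a ≠ b → ¬ G.Adj a b → ∃ c, G.Adj a c ∧ G.Adj b c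
    · obtain ⟨z, hz⟩ := far_or_dom (by omega) h hfar
      exact fan_case (by omega) hN h z hz
    · push Not at hfar
      obtain ⟨u, v, huv, hnad, hc⟩ := hfar
      exact step_far h u v huv hnad (fun c hcc => hc c hcc.1 hcc.2) (ih N (by omega))

/-- For `n ≥ 7`, the complement of a maximal outerplanar graph of order `2n - 3`
has a `K n` minor. -/
theorem maxOuterplanar_compl_Kn (n : ℕ) (hn : 7 ≤ n)
    (G : SimpleGraph (Fin (2 * n - 3))) (hG : IsMaxOuterplanar G) :
    IsMinorOf (⊤ : SimpleGraph (Fin n)) Gᶜ :=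
  nc_main n hn _ (by omega) G hG.2.1
end

section
/- There exists a planar graph G on 11 vertices whose complement does not contain K_7 as a minor. Explicitly, the graph on vertices v_1,…,v_{11} whose complement has edge set {(v_1,v_2),(v_1,v_3),(v_1,v_4),(v_1,v_5),(v_1,v_6),(v_1,v_7),(v_1,v_8),(v_2,v_4),(v_2,v_7),(v_2,v_{11}),(v_3,v_6),(v_3,v_{10}),(v_3,v_{11}),(v_4,v_6),(v_4,v_7),(v_4,v_8),(v_5,v_8),(v_5,v_9),(v_5,v_{11}),(v_6,v_9),(v_6,v_{10}),(v_6,v_{11}),(v_7,v_9),(v_7,v_{10}),(v_7,v_{11}),(v_8,v_9),(v_8,v_{10}),(v_8,v_{11})} is planar, and this 28-edge complement graph has no K_7 minor. -/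
open SimpleGraph

/-- The 28-edge graph on 11 vertices (`i : Fin 11` stands for `v (i+1)`) arising as
the complement of a certain maximal planar graph of order 11. -/
def Hgraph : SimpleGraph (Fin 11) :=
  SimpleGraph.fromEdgeSet
    {s(0,1), s(0,2), s(0,3), s(0,4), s(0,5), s(0,6), s(0,7),
     s(1,3), s(1,6), s(1,10),
     s(2,5), s(2,9), s(2,10),
     s(3,5), s(3,6), s(3,7),
     s(4,7), s(4,8), s(4,10),
     s(5,8), s(5,9), s(5,10),
     s(6,8), s(6,9), s(6,10),
     s(7,8), s(7,9), s(7,10)}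

def candW : List Nat := [
  3670017, 1941506, 970756, 2093062, 3710984, 4124684, 4190222, 1273872, 2093074, 2093076,
  2093078, 3928088, 4190234, 4190236, 4190238, 3176704, 3700993, 4061442, 4061443, 4126980,
  4126981, 4192518, 4192519, 3733768, 3733769, 4061450, 4061451, 4126988, 4126989, 4192526,
  4192527, 4192530, 4192531, 4192532, 4192533, 4192534, 4192535, 3930392, 3930393, 4192538,
  4192539, 4192540, 4192541, 4192542, 4192543, 2677248, 3725825, 4061698, 4061699, 4192774,
  4192775, 3734024, 3734025, 4061706, 4061707, 4127244, 4127245, 4192782, 4192783, 3930640,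
  3930641, 4192786, 4192787, 4192788, 4192789, 4192790, 4192791, 3930648, 3930649, 4192794,
  4192795, 4192796, 4192797, 4192798, 4192799, 3734272, 3734273, 4061954, 4061955, 4127492,
  4127493, 4193030, 4193031, 3734280, 3734281, 4061962, 4061963, 4127500, 4127501, 4193038,
  4193039, 3930896, 3930897, 4193042, 4193043, 4193044, 4193045, 4193046, 4193047, 3930904,
  3930905, 4193050, 4193051, 4193052, 4193053, 4193054, 4193055, 1592320, 3689473, 3730440,
  3730441, 4127756, 4127757, 4193294, 4193295, 3931160, 3931161, 4193306, 4193307, 4193308,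
  4193309, 4193310, 4193311, 3702016, 3702017, 4062466, 4062467, 4128004, 4128005, 4193542,
  4193543, 3734792, 3734793, 4062474, 4062475, 4128012, 4128013, 4193550, 4193551, 4193554,
  4193555, 4193556, 4193557, 4193558, 4193559, 3931416, 3931417, 4193562, 4193563, 4193564,
  4193565, 4193566, 4193567, 3726848, 3726849, 4062722, 4062723, 4193798, 4193799, 3735048,
  3735049, 4062730, 4062731, 4128268, 4128269, 4193806, 4193807, 3931664, 3931665, 4193810,
  4193811, 4193812, 4193813, 4193814, 4193815, 3931672, 3931673, 4193818, 4193819, 4193820,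
  4193821, 4193822, 4193823, 3735296, 3735297, 4062978, 4062979, 4128516, 4128517, 4194054,
  4194055, 3735304, 3735305, 4062986, 4062987, 4128524, 4128525, 4194062, 4194063, 3931920,
  3931921, 4194066, 4194067, 4194068, 4194069, 4194070, 4194071, 3931928, 3931929, 4194074,
  4194075, 4194076, 4194077, 4194078, 4194079]

def candP : List Nat := [
  1941506, 970756, 2093062, 1273872, 2093074, 2093076, 2093078, 430112, 2076706, 2093094,
  1568816, 2093106, 2093108, 2093110, 368704, 1044548, 2093126, 1568848, 2093138, 2093140,
  2093142, 503904, 2076770, 1044580, 2093158, 1568880, 2093170, 2093172, 2093174, 209024,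
  2076802, 1044612, 2093190, 2093202, 2093204, 2093206, 503968, 2076834, 1044644, 2093222,
  1568944, 2093234, 2093236, 2093238, 504000, 2076866, 1044676, 2093254, 1568976, 2093266,
  2093268, 2093270, 504032, 2076898, 1044708, 2093286, 1569008, 2093298, 2093300, 2093302]

def maskW : Nat := 1823

def maskP : Nat := 246

def maskS : Nat := 22

def adjL : List Nat := [1792, 948, 474, 1812, 622, 210, 180, 102, 1551, 1307, 777]

noncomputable def filt (p : Nat → Bool) (l : List Nat) : List Nat :=
  List.rec [] (fun a _ r => Bool.rec r (a :: r) (p a)) l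

noncomputable def band (a b : Bool) : Bool := Bool.rec false b a

noncomputable def bor (a b : Bool) : Bool := Bool.rec b true a

noncomputable def bnot (a : Bool) : Bool := Bool.rec true false a

noncomputable def nonE (l : List Nat) : Bool := List.rec false (fun _ _ _ => true) l

/-- the bit masks `c` and `d` meet -/
noncomputable def hasB (b c : Nat) : Bool := bnot (Nat.beq (Nat.land c b) 0)

noncomputable def disj (c d : Nat) : Bool := Nat.beq (Nat.land d (Nat.mod c 2048)) 0

/-- disjoint, and some vertex of `c` is a neighbour of `d` -/
noncomputable def dt (c d : Nat) : Bool :=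
  band (disj c d) (hasB (Nat.mul (Nat.mod c 2048) 2048) d)

noncomputable def clq (p : Nat → Nat → Bool) : Nat → List Nat → Bool
  | 0, _ => true
  | k + 1, l => List.rec false (fun c l r => bor (clq p k (filt (p c) l)) r) l

noncomputable def ph (j : Nat) : Nat → List Nat → List Nat → Bool
  | 0, _, LB => clq disj j LB
  | k + 1, LA, LB => band (nonE LB)
      (List.rec false (fun c l r => bor (ph j k (filt (disj c) l) (filt (dt c) LB)) r) LA)

/-- neighbourhood mask -/
def nbAux : List Nat → Nat → Nat → Nat
  | [], _, _ => 0
  | a :: l, i, m => (bif m.testBit i then a else 0) ||| nbAux l (i + 1) m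

def nb (m : Nat) : Nat := nbAux adjL 0 m

def code (m : Nat) : Nat := 2048 * nb m + m

def closAux (m : Nat) : Nat → Nat → Nat
  | 0, c => c
  | k + 1, c => closAux m k ((c ||| nb c) &&& m)

/-- closure of the first vertex -/
def clos (m : Nat) : Nat := closAux m 6 (m &&& (m ^^^ (m - 1)))

/-- `c` is a proper nonempty part of `m` without edges to the rest -/
def rej (m c : Nat) : Bool :=
  !(c == 0) && (c &&& m == c) && !(c == m) && ((nb c &&& m) ||| c == c)

def cn (m : Nat) : Bool := !(m == 0) && !(rej m (clos m))

theorem candW_eq : ((List.range 2048).filter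
    (fun m => (m &&& maskW == m) && cn m)).map code = candW := by decide +kernel
theorem candP_eq : ((List.range 2048).filter
    (fun m => (m &&& maskP == m) && cn m)).map code = candP := by decide +kernel

theorem k5W : clq dt 5 candW = false := by decide +kernel
theorem k5P : clq dt 5 candP = false := by decide +kernel
theorem k33W : ph 3 3 candW candW = false := by decide +kernel
theorem k33P : ph 3 3 candP candP = false := by decide +kernel
theorem rW : ph 3 2 (filt (fun c => bnot (hasB maskS c)) candW) (filt (hasB maskS) candW) = false := by
  decide +kernel
theorem rP : ph 3 2 (filt (fun c => bnot (hasB maskS c)) candP) (filt (hasB maskS) candP) = false := by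
  decide +kernel

section search

theorem filt_eq (p : Nat → Bool) (l : List Nat) : filt p l = l.filter p := by
  induction l with
  | nil => rfl
  | cons a l ih =>
    have h : filt p (a :: l) = Bool.rec (filt p l) (a :: filt p l) (p a) := rfl
    rw [h]
    cases hp : p a <;> simp [hp, ih]

theorem mem_filt {p : Nat → Bool} {l : List Nat} {x : Nat} :
    x ∈ filt p l ↔ x ∈ l ∧ p x = true := by
  rw [filt_eq, List.mem_filter]

theorem bor_eq (a b : Bool) : bor a b = (a || b) := by cases a <;> rfl

theorem band_eq (a b : Bool) : band a b = (a && b) := by cases a <;> rfl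

theorem bnot_eq (a : Bool) : bnot a = !a := by cases a <;> rfl

theorem clq_sound {α : Type} [DecidableEq α] (p : Nat → Nat → Bool) (x : α → Nat)
    (hx : Function.Injective x) (k : Nat) :
    ∀ (l : List Nat) (s : Finset α), s.card = k → (∀ a ∈ s, x a ∈ l) →
      (∀ a ∈ s, ∀ b ∈ s, a ≠ b → p (x a) (x b) = true) → clq p k l = true := by
  induction k with
  | zero => intros; rfl
  | succ k ih =>
    intro l
    induction l with
    | nil =>
      intro s hs hl _
      obtain ⟨a, ha⟩ : s.Nonempty := Finset.card_pos.1 (by omega)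
      simpa using hl a ha
    | cons c l ihl =>
      intro s hs hl hp
      have h : clq p (k + 1) (c :: l) = bor (clq p k (filt (p c) l)) (clq p (k + 1) l) := rfl
      rw [h, bor_eq, Bool.or_eq_true]
      by_cases hc : ∃ a ∈ s, x a = c
      · obtain ⟨a, ha, rfl⟩ := hc
        left
        refine ih _ (s.erase a) (by rw [Finset.card_erase_of_mem ha]; omega) ?_ ?_
        · intro b hb
          rw [Finset.mem_erase] at hb
          rw [mem_filt]
          refine ⟨?_, hp _ ha _ hb.2 (Ne.symm hb.1)⟩
          rcases List.mem_cons.1 (hl b hb.2) with h1 | h1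
          · exact absurd (hx h1) hb.1
          · exact h1
        · intro b hb b' hb' hne
          exact hp _ (Finset.mem_of_mem_erase hb) _ (Finset.mem_of_mem_erase hb') hne
      · right
        refine ihl s hs ?_ hp
        intro a ha
        rcases List.mem_cons.1 (hl a ha) with h1 | h1
        · exact absurd ⟨a, ha, h1⟩ hc
        · exact h1

theorem ph_sound {α β : Type} [DecidableEq α] [DecidableEq β] (x : α → Nat) (y : β → Nat)
    (hx : Function.Injective x) (hy : Function.Injective y) (t : Finset β) (ht : t.Nonempty)
    (hyd : ∀ a ∈ t, ∀ b ∈ t, a ≠ b → disj (y a) (y b) = true) (k : Nat) :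
    ∀ (l : List Nat) (s : Finset α) (m : List Nat), s.card = k → (∀ a ∈ s, x a ∈ l) →
      (∀ b ∈ t, y b ∈ m) →
      (∀ a ∈ s, ∀ b ∈ s, a ≠ b → disj (x a) (x b) = true) →
      (∀ a ∈ s, ∀ b ∈ t, dt (x a) (y b) = true) → ph t.card k l m = true := by
  induction k with
  | zero =>
    intro l s m _ _ hm _ _
    exact clq_sound disj y hy t.card m t rfl hm hyd
  | succ k ih =>
    intro l s m hs hl hm hd hdt
    have hne : nonE m = true := by
      obtain ⟨b, hb⟩ := ht
      have := hm b hb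
      cases m with
      | nil => simp at this
      | cons => rfl
    have h0 : ∀ l, ph t.card (k + 1) l m = band (nonE m) (List.rec false
        (fun c l r => bor (ph t.card k (filt (disj c) l) (filt (dt c) m)) r) l) := fun _ => rfl
    induction l generalizing s with
    | nil =>
      obtain ⟨a, ha⟩ : s.Nonempty := Finset.card_pos.1 (by omega)
      simpa using hl a ha
    | cons c l ihl =>
      have h : ph t.card (k + 1) (c :: l) m = true ↔
          (ph t.card k (filt (disj c) l) (filt (dt c) m) = true ∨
            ph t.card (k + 1) l m = true) := by
        rw [h0, h0, hne]
        simp only [band_eq, bor_eq, Bool.true_and, Bool.or_eq_true]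
      rw [h]
      by_cases hc : ∃ a ∈ s, x a = c
      · obtain ⟨a, ha, rfl⟩ := hc
        left
        refine ih _ (s.erase a) _ (by rw [Finset.card_erase_of_mem ha]; omega) ?_ ?_ ?_ ?_
        · intro b hb
          rw [Finset.mem_erase] at hb
          rw [mem_filt]
          refine ⟨?_, hd _ ha _ hb.2 (Ne.symm hb.1)⟩
          rcases List.mem_cons.1 (hl b hb.2) with h1 | h1
          · exact absurd (hx h1) hb.1
          · exact h1
        · intro b hb
          exact mem_filt.2 ⟨hm b hb, hdt a ha b hb⟩
        · intro b hb b' hb' hne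
          exact hd _ (Finset.mem_of_mem_erase hb) _ (Finset.mem_of_mem_erase hb') hne
        · intro b hb b' hb'
          exact hdt _ (Finset.mem_of_mem_erase hb) _ hb'
      · right
        refine ihl s hs ?_ hd hdt
        intro a ha
        rcases List.mem_cons.1 (hl a ha) with h1 | h1
        · exact absurd ⟨a, ha, h1⟩ hc
        · exact h1

end search

section sep

variable {V : Type*}

/-- cut form of connectedness of a vertex set -/
def CutConn (G : SimpleGraph V) (X : Set V) : Prop :=
  X.Nonempty ∧ ∀ T ⊆ X, T.Nonempty → T ≠ X → ∃ u ∈ T, ∃ v ∈ X, v ∉ T ∧ G.Adj u v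

theorem cutConn_of_connected {G : SimpleGraph V} {X : Set V} (h : (G.induce X).Connected) :
    CutConn G X := by
  refine ⟨Set.nonempty_coe_sort.1 h.nonempty, ?_⟩
  intro T hT ⟨t, ht⟩ hne
  obtain ⟨v, hvX, hvT⟩ : ∃ v ∈ X, v ∉ T := by
    by_contra hcon
    push Not at hcon
    exact hne (Set.Subset.antisymm hT hcon)
  obtain ⟨p⟩ := h.preconnected ⟨t, hT ht⟩ ⟨v, hvX⟩
  obtain ⟨d, _, h1, h2⟩ := p.exists_boundary_dart {w | (w : V) ∈ T} ht hvT
  exact ⟨d.fst, h1, d.snd, d.snd.2, h2, d.adj⟩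

/-- clique separation -/
structure Sepn (G : SimpleGraph V) (A B : Set V) : Prop where
  un : ∀ v, v ∈ A ∨ v ∈ B
  ne : ∀ u v, u ∉ B → v ∉ A → ¬ G.Adj u v
  cl : ∀ u v, u ∈ A → u ∈ B → v ∈ A → v ∈ B → u ≠ v → G.Adj u v

theorem Sepn.symm {G : SimpleGraph V} {A B : Set V} (h : Sepn G A B) : Sepn G B A :=
  ⟨fun v => (h.un v).symm, fun u v hu hv hh => h.ne v u hv hu hh.symm,
    fun u v h1 h2 h3 h4 => h.cl u v h2 h1 h4 h3⟩

theorem Sepn.meet {G : SimpleGraph V} {A B X : Set V} (h : Sepn G A B) (hX : CutConn G X)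
    (hA : (X ∩ A).Nonempty) (hB : (X ∩ B).Nonempty) : ∃ s ∈ X, s ∈ A ∧ s ∈ B := by
  obtain ⟨w, hwX, hwB⟩ := hB
  by_cases hE : X ∩ A = X
  · exact ⟨w, hwX, (hE.ge hwX).2, hwB⟩
  · obtain ⟨u, hu, v, hv, hvT, huv⟩ := hX.2 (X ∩ A) Set.inter_subset_left hA hE
    refine ⟨u, hu.1, hu.2, ?_⟩
    by_contra hub
    exact h.ne u v hub (fun hva => hvT ⟨hv, hva⟩) huv

theorem Sepn.conn {G : SimpleGraph V} {A B X : Set V} (h : Sepn G A B) (hX : CutConn G X)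
    (hA : (X ∩ A).Nonempty) : CutConn G (X ∩ A) := by
  refine ⟨hA, ?_⟩
  intro T hT hTn hne
  obtain ⟨z, hz, hzT⟩ : ∃ v ∈ X ∩ A, v ∉ T := by
    by_contra hcon
    push Not at hcon
    exact hne (Set.Subset.antisymm hT hcon)
  by_cases hs : ∃ s ∈ T, s ∈ B
  · obtain ⟨s, hsT, hsB⟩ := hs
    obtain ⟨u, hu, v, hv, hvT, huv⟩ := hX.2 (T ∪ (X \ A))
      (Set.union_subset (fun a ha => (hT ha).1) Set.sdiff_subset) (hTn.mono Set.subset_union_left)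
      (by
        intro he
        have : z ∈ T ∪ (X \ A) := he.ge hz.1
        rcases this with h1 | h1
        · exact hzT h1
        · exact h1.2 hz.2)
    have hvA : v ∈ A := by
      by_contra hc
      exact hvT (Or.inr ⟨hv, hc⟩)
    have hvT' : v ∉ T := fun hc => hvT (Or.inl hc)
    rcases hu with hu | hu
    · exact ⟨u, hu, v, ⟨hv, hvA⟩, hvT', huv⟩
    · have hvB : v ∈ B := by
        by_contra hc
        exact h.ne v u hc hu.2 huv.symm
      exact ⟨s, hsT, v, ⟨hv, hvA⟩, hvT', h.cl s v (hT hsT).2 hsB hvA hvB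
        (fun hc => hvT' (hc ▸ hsT))⟩
  · obtain ⟨u, hu, v, hv, hvT, huv⟩ := hX.2 T (fun a ha => (hT ha).1) hTn
      (fun he => hzT (he ▸ hz.1))
    refine ⟨u, hu, v, ⟨hv, ?_⟩, hvT, huv⟩
    by_contra hc
    exact h.ne u v (fun hub => hs ⟨u, hu, hub⟩) hc huv

theorem Sepn.touch {G : SimpleGraph V} {A B X Y : Set V} (h : Sepn G A B)
    (hX : CutConn G X) (hY : CutConn G Y) (hd : Disjoint X Y)
    (hXA : (X ∩ A).Nonempty) (hYA : (Y ∩ A).Nonempty)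
    (ht : ∃ u ∈ X, ∃ v ∈ Y, G.Adj u v) : ∃ u ∈ X ∩ A, ∃ v ∈ Y ∩ A, G.Adj u v := by
  obtain ⟨u, hu, v, hv, huv⟩ := ht
  by_cases hc : u ∈ A ∧ v ∈ A
  · exact ⟨u, ⟨hu, hc.1⟩, v, ⟨hv, hc.2⟩, huv⟩
  · have huB : u ∈ B := by
      by_contra hub
      have huA : u ∈ A := (h.un u).resolve_right hub
      exact h.ne u v hub (fun hva => hc ⟨huA, hva⟩) huv
    have hvB : v ∈ B := by
      by_contra hvb
      have hvA : v ∈ A := (h.un v).resolve_right hvb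
      exact h.ne v u hvb (fun hua => hc ⟨hua, hvA⟩) huv.symm
    obtain ⟨s, hsX, hsA, hsB⟩ := h.meet hX hXA ⟨u, hu, huB⟩
    obtain ⟨s', hsX', hsA', hsB'⟩ := h.meet hY hYA ⟨v, hv, hvB⟩
    exact ⟨s, ⟨hsX, hsA⟩, s', ⟨hsX', hsA'⟩, h.cl _ _ hsA hsB hsA' hsB'
      (fun he => Set.disjoint_left.1 hd hsX (he ▸ hsX'))⟩

end sep

section bits

theorem hG : ∀ u v : Fin 11, Hgraph.Adj u v ↔
    (u ≠ v ∧ (adjL.getD u.val 0).testBit v.val = false) := by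
  unfold Hgraph
  simp only [SimpleGraph.fromEdgeSet_adj, Set.mem_insert_iff, Set.mem_singleton_iff]
  decide +kernel

theorem hGc (u v : Fin 11) (h : Hgraphᶜ.Adj u v) :
    (adjL.getD u.val 0).testBit v.val = true := by
  rw [SimpleGraph.compl_adj, hG] at h
  by_contra hc
  exact h.2 ⟨h.1, by simpa using hc⟩

theorem nbAux_bit (v m : Nat) (l : List Nat) : ∀ (i k : Nat), m.testBit (i + k) = true →
    (l.getD k 0).testBit v = true → (nbAux l i m).testBit v = true := by
  induction l with
  | nil => intro i k _ h; simp at h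
  | cons a l ih =>
    intro i k hm h
    rw [nbAux, Nat.testBit_or, Bool.or_eq_true]
    cases k with
    | zero => left; simp at hm h; simp [hm, h]
    | succ k => right; exact ih (i + 1) k (by rw [← hm]; congr 1; omega) (by simpa using h)

theorem nb_bit {m : Nat} {u v : Fin 11} (h : Hgraphᶜ.Adj u v) (hm : m.testBit u.val = true) :
    (nb m).testBit v.val = true :=
  nbAux_bit v m adjL 0 u (by simpa using hm) (hGc u v h)

open Classical in
noncomputable def msk (X : Set (Fin 11)) : Nat := Nat.ofBits (fun v : Fin 11 => decide (v ∈ X))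

theorem msk_lt (X : Set (Fin 11)) : msk X < 2048 := Nat.ofBits_lt_two_pow _

theorem msk_bit (X : Set (Fin 11)) (v : Fin 11) : (msk X).testBit v.val = true ↔ v ∈ X := by
  unfold msk
  rw [Nat.testBit_ofBits_lt _ _ v.2]
  simp

theorem msk_bit' {X : Set (Fin 11)} {i : Nat} (h : (msk X).testBit i = true) :
    ∃ v : Fin 11, v.val = i ∧ v ∈ X := by
  have hi : i < 11 := by
    by_contra hc
    rw [msk, Nat.testBit_ofBits_ge _ _ (by omega)] at h
    simp at h
  exact ⟨⟨i, hi⟩, rfl, (msk_bit X ⟨i, hi⟩).1 h⟩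

theorem code_mod {m : Nat} (h : m < 2048) : code m % 2048 = m := by
  unfold code; omega

theorem msk_inj {X Y : Set (Fin 11)} (h : code (msk X) = code (msk Y)) : X = Y := by
  have h1 : msk X = msk Y := by
    rw [← code_mod (msk_lt X), h, code_mod (msk_lt Y)]
  ext v
  rw [← msk_bit, ← msk_bit, h1]

theorem code_bit (m : Nat) (h : m < 2048) (i : Nat) :
    (code m).testBit i = if i < 11 then m.testBit i else (nb m).testBit (i - 11) :=
  Nat.testBit_two_pow_mul_add (nb m) (i := 11) h i

theorem disj_code {X Y : Set (Fin 11)} (h : Disjoint X Y) :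
    disj (code (msk X)) (code (msk Y)) = true := by
  have h0 : (code (msk Y)) &&& (code (msk X) % 2048) = 0 := by
    rw [code_mod (msk_lt X)]
    apply Nat.eq_of_testBit_eq
    intro i
    rw [Nat.testBit_and, Nat.zero_testBit, code_bit _ (msk_lt Y)]
    by_contra hc
    simp only [Bool.not_eq_false, Bool.and_eq_true] at hc
    obtain ⟨v, rfl, hv⟩ := msk_bit' hc.2
    rw [if_pos v.2] at hc
    exact Set.disjoint_left.1 h hv ((msk_bit Y v).1 hc.1)
  change Nat.beq ((code (msk Y)) &&& (code (msk X) % 2048)) 0 = true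
  rw [h0]
  rfl

theorem hasB_iff (b c : Nat) : hasB b c = true ↔ c &&& b ≠ 0 := by
  have : hasB b c = !(Nat.beq (c &&& b) 0) := bnot_eq _
  rw [this]
  cases h : Nat.beq (c &&& b) 0
  · simpa using Nat.ne_of_beq_eq_false h
  · simpa using Nat.eq_of_beq_eq_true h

theorem hasB_of_bit {b c i : Nat} (h1 : b.testBit i = true) (h2 : c.testBit i = true) :
    hasB b c = true := by
  rw [hasB_iff]
  intro h
  have := congrArg (fun n => n.testBit i) h
  simp [Nat.testBit_and, h1, h2] at this

theorem dt_code {X Y : Set (Fin 11)} (h : Disjoint X Y)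
    (ht : ∃ u ∈ X, ∃ v ∈ Y, Hgraphᶜ.Adj u v) :
    dt (code (msk X)) (code (msk Y)) = true := by
  obtain ⟨u, hu, v, hv, huv⟩ := ht
  unfold dt
  rw [band_eq, disj_code h, Bool.true_and]
  have h1 : Nat.mod (code (msk X)) 2048 = msk X := code_mod (msk_lt X)
  rw [h1]
  apply hasB_of_bit (i := u.val + 11)
  · have : (msk X).mul 2048 = 2 ^ 11 * msk X := Nat.mul_comm _ _
    rw [this, Nat.testBit_two_pow_mul]
    simp [(msk_bit X u).2 hu]
  · rw [code_bit _ (msk_lt Y), if_neg (by omega)]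
    simpa using nb_bit huv.symm ((msk_bit Y v).2 hv)

theorem cn_msk {X : Set (Fin 11)} (h : CutConn Hgraphᶜ X) : cn (msk X) = true := by
  obtain ⟨x, hx⟩ := h.1
  have h0 : msk X ≠ 0 := by
    intro h0
    have := (msk_bit X x).2 hx
    simp [h0] at this
  generalize hc : clos (msk X) = c
  have hr : rej (msk X) c = false := by
    by_contra hr
    simp only [rej, Bool.not_eq_false, Bool.and_eq_true, Bool.not_eq_true', beq_eq_false_iff_ne,
      beq_iff_eq] at hr
    obtain ⟨⟨⟨hc0, hcm⟩, hne⟩, hcl⟩ := hr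
    have hsub : ∀ i, c.testBit i = true → (msk X).testBit i = true := by
      intro i hi
      rw [← hcm, Nat.testBit_and, Bool.and_eq_true] at hi
      exact hi.2
    obtain ⟨u, hu, v, hv, hvT, huv⟩ := h.2 {v | c.testBit v.val = true}
      (fun v hv => (msk_bit X v).1 (hsub _ hv))
      (by
        obtain ⟨i, hi⟩ := Nat.exists_testBit_of_ne_zero hc0
        obtain ⟨v, rfl, _⟩ := msk_bit' (hsub i hi)
        exact ⟨v, hi⟩)
      (by
        intro he
        apply hne
        apply Nat.eq_of_testBit_eq
        intro i
        rw [Bool.eq_iff_iff]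
        refine ⟨hsub i, fun hi => ?_⟩
        obtain ⟨v, rfl, hv⟩ := msk_bit' hi
        rw [← he] at hv
        exact hv)
    apply hvT
    change c.testBit v.val = true
    rw [← hcl, Nat.testBit_or, Nat.testBit_and, nb_bit huv hu, (msk_bit X v).2 hv]
    rfl
  simp [cn, hc, hr, h0]

def ofM (M : Nat) : Set (Fin 11) := {v | M.testBit v.val = true}

theorem msk_sub {X : Set (Fin 11)} {M : Nat} (h : X ⊆ ofM M) : msk X &&& M = msk X := by
  apply Nat.eq_of_testBit_eq
  intro i
  rw [Nat.testBit_and]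
  by_cases hi : (msk X).testBit i = true
  · obtain ⟨v, rfl, hv⟩ := msk_bit' hi
    have : M.testBit v.val = true := h hv
    rw [this, Bool.and_true]
  · simp at hi
    simp [hi]

/-- `L` lists all connected sets inside the mask `M` -/
def ListsAll (M : Nat) (L : List Nat) : Prop :=
  ∀ X : Set (Fin 11), CutConn Hgraphᶜ X → X ⊆ ofM M → code (msk X) ∈ L

theorem listsOf {M : Nat} {L : List Nat}
    (h : ((List.range 2048).filter (fun m => (m &&& M == m) && cn m)).map code = L) :
    ListsAll M L := by
  intro X hX hM
  rw [← h]
  refine List.mem_map_of_mem (List.mem_filter.2 ⟨List.mem_range.2 (msk_lt X), ?_⟩)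
  simp [msk_sub hM, cn_msk hX]

theorem sepWP : Sepn Hgraphᶜ (ofM maskW) (ofM maskP) := by
  have k1 : ∀ u : Fin 11, maskW.testBit u.val = true ∨ maskP.testBit u.val = true := by
    decide +kernel
  have k2 : ∀ u v : Fin 11, maskP.testBit u.val = true ∨ maskW.testBit v.val = true ∨
      (u = v ∨ (adjL.getD u.val 0).testBit v.val = false) := by
    decide +kernel
  have k3 : ∀ u v : Fin 11, (maskW.testBit u.val && maskP.testBit u.val && maskW.testBit v.val &&
        maskP.testBit v.val) = true → u = v ∨ (adjL.getD u.val 0).testBit v.val = true := by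
    decide +kernel
  refine ⟨fun v => k1 v, fun u v hu hv => ?_, fun u v h1 h2 h3 h4 h5 => ?_⟩
  · rw [SimpleGraph.compl_adj, hG]
    rintro ⟨h1, h2⟩
    rcases k2 u v with h | h | h | h
    · exact hu h
    · exact hv h
    · exact h1 h
    · exact h2 ⟨h1, h⟩
  · rw [SimpleGraph.compl_adj, hG]
    refine ⟨h5, fun h => ?_⟩
    have h1 : maskW.testBit u.val = true := h1
    have h2 : maskP.testBit u.val = true := h2
    have h3 : maskW.testBit v.val = true := h3
    have h4 : maskP.testBit v.val = true := h4
    rcases k3 u v (by rw [h1, h2, h3, h4]; rfl) with h' | h'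
    · exact h5 h'
    · rw [h'] at h
      exact Bool.noConfusion h.2

end bits

section main

theorem code_inj {α : Type} {f : α → Set (Fin 11)} (hn : ∀ a, (f a).Nonempty)
    (hd : ∀ a b, a ≠ b → Disjoint (f a) (f b)) :
    Function.Injective (fun a => code (msk (f a))) := by
  intro a b h
  by_contra hne
  have h1 := msk_inj h
  have h2 := hd a b hne
  rw [h1] at h2
  obtain ⟨x, hx⟩ := hn b
  exact Set.disjoint_left.1 h2 hx hx

theorem k5_side {M : Nat} {L : List Nat} (hL : ListsAll M L) (h5 : clq dt 5 L = false)
    (f : Fin 5 → Set (Fin 11)) (hc : ∀ a, CutConn Hgraphᶜ (f a)) (hs : ∀ a, f a ⊆ ofM M)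
    (hd : ∀ a b, a ≠ b → Disjoint (f a) (f b))
    (ht : ∀ a b, a ≠ b → ∃ u ∈ f a, ∃ v ∈ f b, Hgraphᶜ.Adj u v) : False := by
  have := clq_sound dt (fun a => code (msk (f a))) (code_inj (fun a => (hc a).1) hd) 5 L
    Finset.univ (by simp) (fun a _ => hL _ (hc a) (hs a))
    (fun a _ b _ hab => dt_code (hd a b hab) (ht a b hab))
  rw [h5] at this
  simp at this

theorem ph_side {α : Type} [DecidableEq α] [Fintype α] {LA LB : List Nat}
    (h33 : ph 3 (Fintype.card α) LA LB = false)
    (f : α → Set (Fin 11)) (g : Fin 3 → Set (Fin 11))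
    (hf : ∀ a, code (msk (f a)) ∈ LA) (hg : ∀ a, code (msk (g a)) ∈ LB)
    (hfn : ∀ a, (f a).Nonempty) (hgn : ∀ a, (g a).Nonempty)
    (hfd : ∀ a b, a ≠ b → Disjoint (f a) (f b)) (hgd : ∀ a b, a ≠ b → Disjoint (g a) (g b))
    (hfg : ∀ a b, Disjoint (f a) (g b))
    (ht : ∀ a b, ∃ u ∈ f a, ∃ v ∈ g b, Hgraphᶜ.Adj u v) : False := by
  have := ph_sound (fun a => code (msk (f a))) (fun a => code (msk (g a))) (code_inj hfn hfd)
    (code_inj hgn hgd) Finset.univ (by simp) (fun a _ b _ hab => disj_code (hgd a b hab))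
    (Fintype.card α) LA Finset.univ LB (by simp) (fun a _ => hf a) (fun b _ => hg b)
    (fun a _ b _ hab => disj_code (hfd a b hab)) (fun a _ b _ => dt_code (hfg a b) (ht a b))
  rw [Finset.card_univ, Fintype.card_fin, h33] at this
  simp at this

theorem noK5 : ¬ IsMinorOf (⊤ : SimpleGraph (Fin 5)) Hgraphᶜ := by
  rintro ⟨f, hc, hd, ht⟩
  have hc' := fun a => cutConn_of_connected (hc a)
  have ht' : ∀ a b, a ≠ b → ∃ u ∈ f a, ∃ v ∈ f b, Hgraphᶜ.Adj u v :=
    fun a b hab => ht a b hab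
  have side : ∀ (A B : Set (Fin 11)) (M : Nat) (L : List Nat), Sepn Hgraphᶜ A B → A = ofM M →
      ListsAll M L → clq dt 5 L = false → (∀ a, (f a ∩ A).Nonempty) → False := by
    intro A B M L hS hA hL h5 hm
    refine k5_side hL h5 (fun a => f a ∩ A) (fun a => hS.conn (hc' a) (hm a))
      (fun a => hA ▸ Set.inter_subset_right)
      (fun a b hab => (hd a b hab).mono Set.inter_subset_left Set.inter_subset_left)
      (fun a b hab => hS.touch (hc' a) (hc' b) (hd a b hab) (hm a) (hm b) (ht' a b hab))
  by_cases hW : ∀ a, (f a ∩ ofM maskW).Nonempty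
  · exact side _ _ _ _ sepWP rfl (listsOf candW_eq) k5W hW
  by_cases hP : ∀ a, (f a ∩ ofM maskP).Nonempty
  · exact side _ _ _ _ sepWP.symm rfl (listsOf candP_eq) k5P hP
  push Not at hW hP
  obtain ⟨a, ha⟩ := hW
  obtain ⟨b, hb⟩ := hP
  have hab : a ≠ b := by
    rintro rfl
    obtain ⟨x, hx⟩ := (hc' a).1
    rcases sepWP.un x with h | h
    · exact (Set.eq_empty_iff_forall_notMem.1 ha x) ⟨hx, h⟩
    · exact (Set.eq_empty_iff_forall_notMem.1 hb x) ⟨hx, h⟩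
  obtain ⟨u, hu, v, hv, huv⟩ := ht' b a hab.symm
  exact sepWP.ne u v (fun h => Set.eq_empty_iff_forall_notMem.1 hb u ⟨hu, h⟩)
    (fun h => Set.eq_empty_iff_forall_notMem.1 ha v ⟨hv, h⟩) huv

/-- two branch sets off the separator and three rooted ones -/
theorem rooted {A B : Set (Fin 11)} {M : Nat} {L : List Nat} (hS : Sepn Hgraphᶜ A B)
    (hA : A = ofM M) (hAB : ∀ v, v ∈ A → v ∈ B → v ∈ ofM maskS)
    (hSB : ∀ v, v ∈ ofM maskS → v ∈ B) (hL : ListsAll M L)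
    (hr : ph 3 2 (filt (fun c => bnot (hasB maskS c)) L) (filt (hasB maskS) L) = false)
    (f : Fin 2 → Set (Fin 11)) (g : Fin 3 → Set (Fin 11))
    (hf : ∀ a, CutConn Hgraphᶜ (f a)) (hg : ∀ a, CutConn Hgraphᶜ (g a))
    (hfd : ∀ a b, a ≠ b → Disjoint (f a) (f b)) (hgd : ∀ a b, a ≠ b → Disjoint (g a) (g b))
    (hfg : ∀ a b, Disjoint (f a) (g b))
    (ht : ∀ a b, ∃ u ∈ f a, ∃ v ∈ g b, Hgraphᶜ.Adj u v)
    (hfB : ∀ a, ∀ v ∈ f a, v ∉ B) (hgB : ∀ b, ∃ s ∈ g b, s ∈ A ∧ s ∈ B) : False := by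
  have hfA : ∀ a, f a ⊆ A := fun a v hv => (hS.un v).resolve_right (hfB a v hv)
  have hgA : ∀ b, (g b ∩ A).Nonempty := fun b => by
    obtain ⟨s, h1, h2, _⟩ := hgB b
    exact ⟨s, h1, h2⟩
  refine ph_side (α := Fin 2) hr f (fun b => g b ∩ A) ?_ ?_ (fun a => (hf a).1) hgA hfd
    (fun a b hab => (hgd a b hab).mono Set.inter_subset_left Set.inter_subset_left)
    (fun a b => (hfg a b).mono_right Set.inter_subset_left) ?_
  · intro a
    rw [mem_filt]
    refine ⟨hL _ (hf a) (hA ▸ hfA a), ?_⟩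
    rw [bnot_eq, Bool.not_eq_true', ← Bool.not_eq_true, hasB_iff, not_not]
    apply Nat.eq_of_testBit_eq
    intro i
    rw [Nat.testBit_and, Nat.zero_testBit, code_bit _ (msk_lt _)]
    by_contra hc
    simp only [Bool.not_eq_false, Bool.and_eq_true] at hc
    have hi : i < 11 := by
      by_contra hi
      have : maskS.testBit i = false := Nat.testBit_lt_two_pow
        (lt_of_lt_of_le (by decide : maskS < 2 ^ 11) (Nat.pow_le_pow_right (by norm_num) (by omega)))
      rw [this] at hc
      simp at hc
    rw [if_pos hi] at hc
    obtain ⟨v, rfl, hv⟩ := msk_bit' hc.1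
    exact hfB a v hv (hSB v hc.2)
  · intro b
    rw [mem_filt]
    refine ⟨hL _ (hS.conn (hg b) (hgA b)) (hA ▸ Set.inter_subset_right), ?_⟩
    obtain ⟨s, h1, h2, h3⟩ := hgB b
    refine hasB_of_bit (i := s.val) (hAB s h2 h3) ?_
    rw [code_bit _ (msk_lt _), if_pos s.2]
    exact (msk_bit _ _).2 ⟨h1, h2⟩
  · intro a b
    obtain ⟨u, hu, v, hv, huv⟩ := ht a b
    refine ⟨u, hu, v, ⟨hv, ?_⟩, huv⟩
    by_contra hva
    exact hS.ne u v (hfB a u hu) hva huv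

theorem maskS_iff : ∀ v : Fin 11, (v ∈ ofM maskS ↔ v ∈ ofM maskW ∧ v ∈ ofM maskP) := by
  have : ∀ v : Fin 11, (maskS.testBit v.val = true ↔
      maskW.testBit v.val = true ∧ maskP.testBit v.val = true) := by decide +kernel
  exact this

theorem maskS_pig : ∀ a b c d : Fin 11, a ∈ ofM maskS → b ∈ ofM maskS → c ∈ ofM maskS →
    d ∈ ofM maskS → a ≠ b → a ≠ c → a ≠ d → b ≠ c → b ≠ d → c ≠ d → False := by
  have h : ∀ a : Fin 11, a ∈ ofM maskS → a = 1 ∨ a = 2 ∨ a = 4 := by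
    have : ∀ a : Fin 11, maskS.testBit a.val = true → a = 1 ∨ a = 2 ∨ a = 4 := by decide +kernel
    exact this
  intro a b c d ha hb hc hd
  have := h a ha
  have := h b hb
  have := h c hc
  have := h d hd
  grind

theorem mixed (f g : Fin 3 → Set (Fin 11))
    (hf : ∀ a, CutConn Hgraphᶜ (f a)) (hg : ∀ a, CutConn Hgraphᶜ (g a))
    (hfd : ∀ a b, a ≠ b → Disjoint (f a) (f b)) (hgd : ∀ a b, a ≠ b → Disjoint (g a) (g b))
    (hfg : ∀ a b, Disjoint (f a) (g b))
    (ht : ∀ a b, ∃ u ∈ f a, ∃ v ∈ g b, Hgraphᶜ.Adj u v)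
    (i j : Fin 3) (hi : ∀ v ∈ f i, v ∉ ofM maskW) (hj : ∀ v ∈ f j, v ∉ ofM maskP) : False := by
  have hij : i ≠ j := by
    rintro rfl
    obtain ⟨x, hx⟩ := (hf i).1
    rcases sepWP.un x with h | h
    · exact hi x hx h
    · exact hj x hx h
  have hgS : ∀ b, ∃ s ∈ g b, s ∈ ofM maskW ∧ s ∈ ofM maskP := by
    intro b
    apply sepWP.meet (hg b)
    · obtain ⟨u, hu, v, hv, huv⟩ := ht j b
      refine ⟨v, hv, ?_⟩
      by_contra hc
      exact sepWP.ne u v (hj u hu) hc huv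
    · obtain ⟨u, hu, v, hv, huv⟩ := ht i b
      refine ⟨v, hv, ?_⟩
      by_contra hc
      exact sepWP.ne v u hc (hi u hu) huv.symm
  obtain ⟨l, hli, hlj⟩ : ∃ l : Fin 3, l ≠ i ∧ l ≠ j := by
    have h3 : ∀ i j : Fin 3, ∃ l : Fin 3, l ≠ i ∧ l ≠ j := by decide
    exact h3 i j
  have hlS : ∀ s ∈ f l, s ∈ ofM maskW → s ∈ ofM maskP → False := by
    intro s hs h1 h2
    choose t ht1 ht2 using hgS
    have e1 : ∀ b, s ≠ t b := fun b he => Set.disjoint_left.1 (hfg l b) hs (he ▸ ht1 b)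
    have e2 : ∀ b b', b ≠ b' → t b ≠ t b' := fun b b' hb he =>
      Set.disjoint_left.1 (hgd b b' hb) (ht1 b) (he ▸ ht1 b')
    exact maskS_pig s (t 0) (t 1) (t 2) ((maskS_iff _).2 ⟨h1, h2⟩) ((maskS_iff _).2 (ht2 0))
      ((maskS_iff _).2 (ht2 1)) ((maskS_iff _).2 (ht2 2)) (e1 0) (e1 1) (e1 2)
      (e2 0 1 (by decide)) (e2 0 2 (by decide)) (e2 1 2 (by decide))
  have hinj : ∀ k, l ≠ k → ∀ a b : Fin 2, a ≠ b →
      Disjoint (f ((![l, k] : Fin 2 → Fin 3) a)) (f ((![l, k] : Fin 2 → Fin 3) b)) := by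
    intro k hk a b hab
    apply hfd
    fin_cases a <;> fin_cases b <;> simp at hab ⊢
    · exact hk
    · exact hk.symm
  by_cases hm : (f l ∩ ofM maskP).Nonempty
  · have hlW : ∀ v ∈ f l, v ∉ ofM maskW := by
      intro v hv hvW
      obtain ⟨s, h1, h2, h3⟩ := sepWP.meet (hf l) ⟨v, hv, hvW⟩ hm
      exact hlS s h1 h2 h3
    refine rooted sepWP.symm rfl (fun v h1 h2 => (maskS_iff v).2 ⟨h2, h1⟩)
      (fun v h => ((maskS_iff v).1 h).1) (listsOf candP_eq) rP (fun a => f (![l, i] a)) g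
      (fun a => hf _) hg (hinj i hli) hgd (fun a b => hfg _ b) (fun a b => ht _ b) ?_ ?_
    · intro a
      fin_cases a
      · exact hlW
      · exact hi
    · intro b
      obtain ⟨s, h1, h2, h3⟩ := hgS b
      exact ⟨s, h1, h3, h2⟩
  · have hlP : ∀ v ∈ f l, v ∉ ofM maskP := fun v hv hvP => hm ⟨v, hv, hvP⟩
    refine rooted sepWP rfl (fun v h1 h2 => (maskS_iff v).2 ⟨h1, h2⟩)
      (fun v h => ((maskS_iff v).1 h).2) (listsOf candW_eq) rW (fun a => f (![l, j] a)) g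
      (fun a => hf _) hg (hinj j hlj) hgd (fun a b => hfg _ b) (fun a b => ht _ b) ?_ hgS
    intro a
    fin_cases a
    · exact hlP
    · exact hj

theorem noK33 : ¬ IsMinorOf (completeBipartiteGraph (Fin 3) (Fin 3)) Hgraphᶜ := by
  rintro ⟨f, hc, hd, ht⟩
  have hc' := fun a => cutConn_of_connected (hc a)
  have ht1 : ∀ a b : Fin 3, ∃ u ∈ f (Sum.inl a), ∃ v ∈ f (Sum.inr b), Hgraphᶜ.Adj u v :=
    fun a b => ht _ _ (by simp)
  have ht2 : ∀ a b : Fin 3, ∃ u ∈ f (Sum.inr a), ∃ v ∈ f (Sum.inl b), Hgraphᶜ.Adj u v :=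
    fun a b => ht _ _ (by simp)
  have side : ∀ (A B : Set (Fin 11)) (M : Nat) (L : List Nat), Sepn Hgraphᶜ A B → A = ofM M →
      ListsAll M L → ph 3 3 L L = false → (∀ a, (f a ∩ A).Nonempty) → False := by
    intro A B M L hS hA hL h5 hm
    have hd' : ∀ a b, a ≠ b → Disjoint (f a ∩ A) (f b ∩ A) :=
      fun a b hab => (hd a b hab).mono Set.inter_subset_left Set.inter_subset_left
    refine ph_side (α := Fin 3) h5 (fun a => f (Sum.inl a) ∩ A) (fun a => f (Sum.inr a) ∩ A)
      (fun a => hL _ (hS.conn (hc' _) (hm _)) (hA ▸ Set.inter_subset_right))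
      (fun a => hL _ (hS.conn (hc' _) (hm _)) (hA ▸ Set.inter_subset_right))
      (fun a => hm _) (fun a => hm _)
      (fun a b hab => hd' _ _ (by simpa using hab)) (fun a b hab => hd' _ _ (by simpa using hab))
      (fun a b => hd' _ _ (by simp))
      (fun a b => hS.touch (hc' _) (hc' _) (hd _ _ (by simp)) (hm _) (hm _) (ht1 a b))
  by_cases hW : ∀ a, (f a ∩ ofM maskW).Nonempty
  · exact side _ _ _ _ sepWP rfl (listsOf candW_eq) k33W hW
  by_cases hP : ∀ a, (f a ∩ ofM maskP).Nonempty
  · exact side _ _ _ _ sepWP.symm rfl (listsOf candP_eq) k33P hP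
  push Not at hW hP
  obtain ⟨a, ha⟩ := hW
  obtain ⟨b, hb⟩ := hP
  have ha' : ∀ v ∈ f a, v ∉ ofM maskW :=
    fun v hv h => Set.eq_empty_iff_forall_notMem.1 ha v ⟨hv, h⟩
  have hb' : ∀ v ∈ f b, v ∉ ofM maskP :=
    fun v hv h => Set.eq_empty_iff_forall_notMem.1 hb v ⟨hv, h⟩
  have hno : ¬ ∃ u ∈ f b, ∃ v ∈ f a, Hgraphᶜ.Adj u v := by
    rintro ⟨u, hu, v, hv, huv⟩
    exact sepWP.ne u v (hb' u hu) (ha' v hv) huv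
  rcases a with a | a <;> rcases b with b | b
  · exact mixed (fun i => f (Sum.inl i)) (fun i => f (Sum.inr i)) (fun _ => hc' _)
      (fun _ => hc' _) (fun _ _ h => hd _ _ (by simpa using h))
      (fun _ _ h => hd _ _ (by simpa using h)) (fun _ _ => hd _ _ (by simp)) ht1 a b ha' hb'
  · exact hno (ht2 b a)
  · exact hno (ht1 b a)
  · exact mixed (fun i => f (Sum.inr i)) (fun i => f (Sum.inl i)) (fun _ => hc' _)
      (fun _ => hc' _) (fun _ _ h => hd _ _ (by simpa using h))
      (fun _ _ h => hd _ _ (by simpa using h)) (fun _ _ => hd _ _ (by simp)) ht2 a b ha' hb'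

/-- boolean adjacency of `Hgraph` -/
def hb (u v : Fin 11) : Bool := decide (u ≠ v) && !((adjL.getD u.val 0).testBit v.val)

theorem hb_iff (u v : Fin 11) : Hgraph.Adj u v ↔ hb u v = true := by
  rw [hG]; simp [hb]

theorem noK7 : ¬ IsMinorOf (⊤ : SimpleGraph (Fin 7)) Hgraph := by
  classical
  rintro ⟨f, hc, hd, ht⟩
  have hne : ∀ a, (f a).Nonempty := fun a => (cutConn_of_connected (hc a)).1
  have ht' : ∀ a b, a ≠ b → ∃ u ∈ f a, ∃ v ∈ f b, Hgraph.Adj u v :=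
    fun a b hab => ht a b hab
  let F : Fin 7 → Finset (Fin 11) := fun a => Finset.univ.filter (· ∈ f a)
  have hF : ∀ a v, v ∈ F a ↔ v ∈ f a := fun a v => by simp [F]
  have hFd : ∀ a b, a ≠ b → Disjoint (F a) (F b) := fun a b hab =>
    Finset.disjoint_left.2 fun v h1 h2 =>
      Set.disjoint_left.1 (hd a b hab) ((hF a v).1 h1) ((hF b v).1 h2)
  have hF1 : ∀ a, 1 ≤ (F a).card := fun a => by
    obtain ⟨x, hx⟩ := hne a
    exact Finset.card_pos.2 ⟨x, (hF a x).2 hx⟩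
  have hsum : ∑ a, (F a).card ≤ 11 := by
    rw [← Finset.card_biUnion (fun a _ b _ hab => hFd a b hab)]
    exact (Finset.card_le_univ _).trans (by simp)
  let Z : Finset (Fin 7) := Finset.univ.filter (fun a => (F a).card = 1)
  have hZ : 3 ≤ Z.card := by
    have h1 : ∑ a : Fin 7, 2 ≤ ∑ a : Fin 7, ((F a).card + if (F a).card = 1 then 1 else 0) := by
      apply Finset.sum_le_sum
      intro a _
      have := hF1 a
      split_ifs <;> omega
    rw [Finset.sum_add_distrib, ← Finset.card_filter] at h1
    simp only [Finset.sum_const, Finset.card_univ, Fintype.card_fin, smul_eq_mul] at h1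
    change _ ≤ _ + Z.card at h1
    omega
  obtain ⟨Z', hZ', hZ3⟩ := Finset.exists_subset_card_eq hZ
  obtain ⟨a, b, c, hab, hac, hbc, rfl⟩ := Finset.card_eq_three.1 hZ3
  have hsing : ∀ a ∈ Z, ∃ x, (∀ v, v ∈ f a ↔ v = x) ∧
      6 ≤ (Finset.univ.filter (fun v => hb x v = true)).card := by
    intro a ha
    obtain ⟨x, hx⟩ := Finset.card_eq_one.1 (Finset.mem_filter.1 ha).2
    have hxa : ∀ v, v ∈ f a ↔ v = x := fun v => by rw [← hF, hx, Finset.mem_singleton]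
    refine ⟨x, hxa, ?_⟩
    have hw : ∀ b : Fin 7, ∃ w, b ≠ a → w ∈ f b ∧ Hgraph.Adj x w := by
      intro b
      by_cases hba : b = a
      · exact ⟨x, fun h => absurd hba h⟩
      · obtain ⟨u, hu, v, hv, huv⟩ := ht' a b (Ne.symm hba)
        rw [hxa] at hu
        exact ⟨v, fun _ => ⟨hv, hu ▸ huv⟩⟩
    choose w hw using hw
    have : (Finset.univ.erase a).card ≤ (Finset.univ.filter (fun v => hb x v = true)).card := by
      apply Finset.card_le_card_of_injOn w
      · intro b hb'
        have hb' := Finset.ne_of_mem_erase hb'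
        simp [(hb_iff _ _).1 (hw b hb').2]
      · intro b hb1 b' hb2 he
        have h1 := (hw b (Finset.ne_of_mem_erase hb1)).1
        have h2 := (hw b' (Finset.ne_of_mem_erase hb2)).1
        by_contra hne
        exact Set.disjoint_left.1 (hd b b' hne) h1 (he ▸ h2)
    simpa using this
  obtain ⟨x, hx, hx6⟩ := hsing a (hZ' (by simp))
  obtain ⟨y, hy, hy6⟩ := hsing b (hZ' (by simp))
  obtain ⟨z, hz, hz6⟩ := hsing c (hZ' (by simp))
  have adj : ∀ a b x y, a ≠ b → (∀ v, v ∈ f a ↔ v = x) → (∀ v, v ∈ f b ↔ v = y) →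
      hb x y = true := by
    intro a b x y hab hx hy
    obtain ⟨u, hu, v, hv, huv⟩ := ht' a b hab
    rw [hx] at hu
    rw [hy] at hv
    rw [← hb_iff, ← hu, ← hv]
    exact huv
  have key : ∀ x y z : Fin 11, 6 ≤ (Finset.univ.filter (fun v => hb x v = true)).card →
      6 ≤ (Finset.univ.filter (fun v => hb y v = true)).card →
      6 ≤ (Finset.univ.filter (fun v => hb z v = true)).card →
      hb x y = true → hb x z = true → hb y z = true → False := by
    decide +kernel
  refine key x y z ?_ ?_ ?_ (adj a b x y hab hx hy) (adj a c x z hac hx hz)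
    (adj b c y z hbc hy hz)
  · convert hx6
  · convert hy6
  · convert hz6

end main


/-- The complement of `Hgraph` is a planar graph of order 11 (planarity is expressed
via Wagner's theorem: no `K 5` minor and no `K 3,3` minor), while `Hgraph` itself has
no `K 7` minor: a planar graph of order 11 whose complement has no `K 7` minor. -/
theorem exists_planar11_compl_no_K7 :
    (¬ IsMinorOf (⊤ : SimpleGraph (Fin 5)) Hgraphᶜ ∧
      ¬ IsMinorOf (completeBipartiteGraph (Fin 3) (Fin 3)) Hgraphᶜ) ∧
    ¬ IsMinorOf (⊤ : SimpleGraph (Fin 7)) Hgraph := by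
  exact ⟨⟨noK5, noK33⟩, noK7⟩
end
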